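/- Let s ∈ (0,1), let f : ℝ → ℝ be locally Lipschitz, and let v : ℝ² → ℝ be bounded and of class C², satisfying the fractional equation (−Δ)^s v = f(v) in ℝ² in the principal-value sense: for every y ∈ ℝ², the limit lim_{ε→0⁺} ∫_{{z ∈ ℝ² : |z−y| ≥ ε}} (v(y) − v(z))/|y−z|^{2+2s} dz exists and equals f(v(y)). Suppose in addition that either (i) f ≡ 0, or (ii) ∂_{y₂} v(y) > 0 for every y ∈ ℝ². Then there exist a unit vector ω ∈ S¹ ⊂ ℝ² and a function v_o : ℝ → ℝ such that v(y) = v_o(ω·y) for every y ∈ ℝ². -/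

import Mathlib

open MeasureTheory Metric Set Filter
open scoped RealInnerProductSpace Topology

noncomputable section

namespace FractionalSymmetry

/-- The Euclidean plane. -/
abbrev Plane := EuclideanSpace ℝ (Fin 2)

/-- The kernel `|z|^{-(2+2s)}` of the fractional Laplacian in the plane. -/
def kernel (s : ℝ) (z : Plane) : ℝ := (‖z‖ ^ (2 + 2 * s))⁻¹

/-- The kernel multiplied by the weight `min 1 |z|²`, which makes it integrable. -/
def tamed (s : ℝ) (z : Plane) : ℝ := min 1 ‖z‖ ^ 2 * kernel s z

lemma kernel_nonneg (s : ℝ) (z : Plane) : 0 ≤ kernel s z := by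
  unfold kernel; positivity

lemma kernel_pos (s : ℝ) {z : Plane} (hz : z ≠ 0) : 0 < kernel s z := by
  have := norm_pos_iff.2 hz
  unfold kernel; positivity

lemma kernel_neg (s : ℝ) (z : Plane) : kernel s (-z) = kernel s z := by simp [kernel]

lemma kernel_sub_comm (s : ℝ) (x y : Plane) : kernel s (x - y) = kernel s (y - x) := by
  rw [← kernel_neg, neg_sub]

@[fun_prop]
lemma measurable_kernel (s : ℝ) : Measurable (kernel s) := by
  unfold kernel; fun_prop

lemma tamed_nonneg (s : ℝ) (z : Plane) : 0 ≤ tamed s z :=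
  mul_nonneg (by positivity) (kernel_nonneg s z)

lemma tamed_neg (s : ℝ) (z : Plane) : tamed s (-z) = tamed s z := by simp [tamed, kernel]

@[fun_prop]
lemma measurable_tamed (s : ℝ) : Measurable (tamed s) := by
  unfold tamed; fun_prop

lemma integrable_tamed {s : ℝ} (hs : s ∈ Ioo (0 : ℝ) 1) : Integrable (tamed s) := by
  have h := (integrable_fun_norm_addHaar (volume : Measure Plane)
    (f := fun r : ℝ => min 1 r ^ 2 * (r ^ (2 + 2 * s))⁻¹)).2
  refine h ?_
  have hd : Module.finrank ℝ Plane - 1 = 1 := by simp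
  rw [hd, ← Ioc_union_Ioi_eq_Ioi (zero_le_one : (0 : ℝ) ≤ 1)]
  refine IntegrableOn.union ?_ ?_
  · have h1 : IntegrableOn (fun r : ℝ => r ^ (1 - 2 * s)) (Ioc 0 1) :=
      (intervalIntegrable_iff_integrableOn_Ioc_of_le zero_le_one).1
        (intervalIntegral.intervalIntegrable_rpow' (by linarith [hs.2]))
    refine h1.congr_fun (fun r hr => ?_) measurableSet_Ioc
    have hr0 : 0 < r := hr.1
    simp only [min_eq_right hr.2, pow_one, smul_eq_mul]
    rw [← Real.rpow_neg hr0.le, ← Real.rpow_natCast r 2, ← Real.rpow_add hr0]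
    nth_rewrite 2 [← Real.rpow_one r]
    rw [← Real.rpow_add hr0]
    congr 1; push_cast; ring
  · have h1 : IntegrableOn (fun r : ℝ => r ^ (-1 - 2 * s)) (Ioi 1) :=
      integrableOn_Ioi_rpow_of_lt (by linarith [hs.1]) one_pos
    refine h1.congr_fun (fun r hr => ?_) measurableSet_Ioi
    have hr1 : 1 < r := hr
    have hr0 : 0 < r := by linarith
    simp only [min_eq_left hr1.le, pow_one, smul_eq_mul, one_pow, one_mul]
    rw [← Real.rpow_neg hr0.le]
    nth_rewrite 2 [← Real.rpow_one r]
    rw [← Real.rpow_add hr0]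
    congr 1; ring

/-- The dominating function `(1_{B_R}(x) + 1_{B_R}(y)) min(1,|x-y|²) |x-y|^{-(2+2s)}`. -/
def dominator (s R : ℝ) (p : Plane × Plane) : ℝ :=
  ((closedBall (0 : Plane) R).indicator 1 p.1 + (closedBall (0 : Plane) R).indicator 1 p.2) *
    tamed s (p.1 - p.2)

lemma indicator_one_nonneg (A : Set Plane) (x : Plane) : 0 ≤ A.indicator (1 : Plane → ℝ) x :=
  indicator_nonneg (fun _ _ => zero_le_one) x

lemma dominator_nonneg (s R : ℝ) (p : Plane × Plane) : 0 ≤ dominator s R p :=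
  mul_nonneg (add_nonneg (indicator_one_nonneg _ _) (indicator_one_nonneg _ _))
    (tamed_nonneg s _)

lemma integrable_comp_shear {F : Plane × Plane → ℝ} (hF : Integrable F) :
    Integrable (fun p : Plane × Plane => F (p.1, p.1 - p.2)) ∧
      ∫ p : Plane × Plane, F (p.1, p.1 - p.2) = ∫ p, F p := by
  have e : (fun p : Plane × Plane => F (p.1, p.1 - p.2))
      = (fun p : Plane × Plane => F (p.1, -p.2)) ∘ (fun p : Plane × Plane => (p.1, -p.1 + p.2)) := by
    ext p; simp [sub_eq_add_neg, add_comm]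
  have m1 : MeasurePreserving (fun p : Plane × Plane => (p.1, -p.1 + p.2)) :=
    measurePreserving_prod_neg_add (volume : Measure Plane) (volume : Measure Plane)
  have m2 : MeasurePreserving (fun p : Plane × Plane => (p.1, -p.2)) :=
    (MeasurePreserving.id (volume : Measure Plane)).prod
      (Measure.measurePreserving_neg (volume : Measure Plane))
  have m : MeasurePreserving (fun p : Plane × Plane => (p.1, p.1 - p.2)) := by
    convert m2.comp m1 using 2
    simp [sub_eq_add_neg, add_comm]
  refine ⟨m.integrable_comp_of_integrable hF, ?_⟩
  have h := integral_map (μ := (volume : Measure (Plane × Plane)))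
    (φ := fun p : Plane × Plane => (p.1, p.1 - p.2)) m.measurable.aemeasurable (f := F)
    (by rw [m.map_eq]; exact hF.aestronglyMeasurable)
  rw [m.map_eq] at h
  exact h.symm

lemma integrable_prod_sub {f k : Plane → ℝ} (hf : Integrable f) (hk : Integrable k) :
    Integrable (fun p : Plane × Plane => f p.1 * k (p.1 - p.2)) ∧
      ∫ p : Plane × Plane, f p.1 * k (p.1 - p.2) = (∫ x, f x) * ∫ z, k z := by
  have h := integrable_comp_shear (hf.mul_prod hk)
  refine ⟨h.1, h.2.trans ?_⟩
  exact integral_prod_mul f k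

lemma integrable_indicator_ball (R : ℝ) :
    Integrable ((closedBall (0 : Plane) R).indicator (1 : Plane → ℝ)) :=
  (integrable_indicator_iff measurableSet_closedBall).2
    (integrableOn_const measure_closedBall_lt_top.ne)

lemma integral_indicator_ball (R : ℝ) :
    ∫ x, (closedBall (0 : Plane) R).indicator (1 : Plane → ℝ) x
      = volume.real (closedBall (0 : Plane) R) := by
  rw [integral_indicator_one measurableSet_closedBall]

lemma measurePreserving_swap_plane :
    MeasurePreserving (Prod.swap : Plane × Plane → Plane × Plane) :=
  Measure.measurePreserving_swap

lemma integral_swap {F : Plane × Plane → ℝ} : ∫ p : Plane × Plane, F p.swap = ∫ p, F p :=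
  measurePreserving_swap_plane.integral_comp MeasurableEquiv.prodComm.measurableEmbedding F

lemma dominator_integrable {s : ℝ} (hs : s ∈ Ioo (0 : ℝ) 1) (R : ℝ) :
    Integrable (dominator s R) ∧
      ∫ p, dominator s R p = 2 * volume.real (closedBall (0 : Plane) R) * ∫ z, tamed s z := by
  have h := integrable_prod_sub (integrable_indicator_ball R) (integrable_tamed hs)
  have h' := measurePreserving_swap_plane.integrable_comp_of_integrable h.1
  have e : dominator s R = (fun p : Plane × Plane =>
      (closedBall (0 : Plane) R).indicator 1 p.1 * tamed s (p.1 - p.2)) +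
      (fun p : Plane × Plane =>
      (closedBall (0 : Plane) R).indicator 1 p.1 * tamed s (p.1 - p.2)) ∘ Prod.swap := by
    ext p
    simp only [dominator, Pi.add_apply, Function.comp, Prod.fst_swap, Prod.snd_swap, add_mul]
    rw [← tamed_neg s (p.2 - p.1), neg_sub]
  rw [e]
  refine ⟨h.1.add h', ?_⟩
  rw [integral_add' h.1 h']
  have := integral_swap (F := fun p : Plane × Plane =>
      (closedBall (0 : Plane) R).indicator 1 p.1 * tamed s (p.1 - p.2))
  simp only [Function.comp_def]
  rw [this, h.2, integral_indicator_ball]; ring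

lemma volume_ball_le : ∃ C, 0 ≤ C ∧ ∀ R, 0 ≤ R →
    volume.real (closedBall (0 : Plane) R) = C * R ^ 2 := by
  refine ⟨volume.real (ball (0 : Plane) 1), measureReal_nonneg, fun R hR => ?_⟩
  rw [Measure.addHaar_real_closedBall _ _ hR, mul_comm]
  simp

/-- Bounded functions that are Lipschitz near every bounded set. -/
def LocLip (w : Plane → ℝ) : Prop :=
  ∀ R : ℝ, ∃ C, 0 ≤ C ∧ ∀ x y, ‖x‖ ≤ R → |w x - w y| ≤ C * min 1 ‖x - y‖

namespace LocLip

variable {w u : Plane → ℝ}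

lemma bounded (hw : LocLip w) : ∃ M, 0 ≤ M ∧ ∀ x, |w x| ≤ M := by
  obtain ⟨C, hC, h⟩ := hw 0
  refine ⟨|w 0| + C, by positivity, fun x => ?_⟩
  have h1 := h 0 x (by simp)
  have h2 : C * min 1 ‖0 - x‖ ≤ C := mul_le_of_le_one_right hC (min_le_left _ _)
  have h3 := abs_sub_abs_le_abs_sub (w x) (w 0)
  rw [abs_sub_comm] at h3
  linarith

lemma continuous (hw : LocLip w) : Continuous w := by
  rw [continuous_iff_continuousAt]
  intro x
  obtain ⟨C, hC, h⟩ := hw ‖x‖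
  rw [ContinuousAt, tendsto_iff_dist_tendsto_zero]
  have h0 : Tendsto (fun y => C * ‖x - y‖) (𝓝 x) (𝓝 0) := by
    have : Continuous fun y => C * ‖x - y‖ := by fun_prop
    simpa using this.tendsto x
  refine squeeze_zero (fun _ => dist_nonneg) (fun y => ?_) h0
  rw [Real.dist_eq, abs_sub_comm]
  exact (h x y le_rfl).trans (mul_le_mul_of_nonneg_left (min_le_right _ _) hC)

lemma of_contDiff (hb : ∃ M : ℝ, ∀ y, |w y| ≤ M) (hc : ContDiff ℝ 1 w) : LocLip w := by
  intro R
  obtain ⟨M, hM⟩ := hb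
  have hM0 : 0 ≤ M := (abs_nonneg _).trans (hM 0)
  obtain ⟨D, hD⟩ := (isCompact_closedBall (0 : Plane) (R + 1)).exists_bound_of_continuousOn
    (hc.continuous_fderiv one_ne_zero).continuousOn
  refine ⟨max (2 * M) D, le_max_of_le_left (by positivity), fun x y hx => ?_⟩
  rcases le_total ‖x - y‖ 1 with h | h
  · rw [min_eq_right h]
    have hx' : x ∈ closedBall (0 : Plane) (R + 1) := by simp; linarith
    have hy' : y ∈ closedBall (0 : Plane) (R + 1) := by
      have := norm_sub_norm_le y x
      rw [norm_sub_rev] at this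
      simp; linarith
    have := (convex_closedBall (0 : Plane) (R + 1)).norm_image_sub_le_of_norm_fderiv_le
      (fun z _ => hc.differentiable one_ne_zero z) hD hy' hx'
    exact this.trans (mul_le_mul_of_nonneg_right (le_max_right _ _) (norm_nonneg _))
  · rw [min_eq_left h, mul_one]
    refine le_max_of_le_left ?_
    have := abs_sub (w x) (w y)
    linarith [hM x, hM y]

lemma comp_add (hw : LocLip w) (a : Plane) : LocLip (fun x => w (x + a)) := by
  intro R
  obtain ⟨C, hC, h⟩ := hw (R + ‖a‖)
  refine ⟨C, hC, fun x y hx => ?_⟩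
  simpa using h (x + a) (y + a) ((norm_add_le _ _).trans (by linarith))

lemma sub (hw : LocLip w) (hu : LocLip u) : LocLip (fun x => w x - u x) := by
  intro R
  obtain ⟨C, hC, h⟩ := hw R
  obtain ⟨D, hD, h'⟩ := hu R
  refine ⟨C + D, by positivity, fun x y hx => ?_⟩
  have e : w x - u x - (w y - u y) = (w x - w y) - (u x - u y) := by ring
  rw [e, add_mul]
  exact (abs_sub _ _).trans (add_le_add (h x y hx) (h' x y hx))

lemma mul (hw : LocLip w) (hu : LocLip u) : LocLip (fun x => w x * u x) := by
  intro R
  obtain ⟨C, hC, h⟩ := hw R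
  obtain ⟨D, hD, h'⟩ := hu R
  obtain ⟨M, hM, b⟩ := hw.bounded
  obtain ⟨N, hN, b'⟩ := hu.bounded
  refine ⟨M * D + N * C, by positivity, fun x y hx => ?_⟩
  have e : w x * u x - w y * u y = w x * (u x - u y) + u y * (w x - w y) := by ring
  rw [e]
  refine (abs_add_le _ _).trans ?_
  rw [abs_mul, abs_mul]
  have h1 := mul_le_mul (b x) (h' x y hx) (abs_nonneg _) hM
  have h2 := mul_le_mul (b' y) (h x y hx) (abs_nonneg _) hN
  nlinarith

lemma inv (hw : LocLip w) {c : ℝ} (hc : 0 < c) (hcw : ∀ x, c ≤ w x) :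
    LocLip (fun x => (w x)⁻¹) := by
  intro R
  obtain ⟨C, hC, h⟩ := hw R
  refine ⟨C / c ^ 2, by positivity, fun x y hx => ?_⟩
  have hx0 : 0 < w x := hc.trans_le (hcw x)
  have hy0 : 0 < w y := hc.trans_le (hcw y)
  rw [inv_sub_inv hx0.ne' hy0.ne', abs_div, abs_sub_comm, abs_of_pos (mul_pos hx0 hy0),
    div_mul_eq_mul_div]
  refine div_le_div₀ (by positivity) (h x y hx) (by positivity) ?_
  rw [sq]
  exact mul_le_mul (hcw x) (hcw y) hc.le hx0.le

lemma max_const (hw : LocLip w) (c : ℝ) : LocLip (fun x => max (w x) c) := by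
  intro R
  obtain ⟨C, hC, h⟩ := hw R
  exact ⟨C, hC, fun x y hx => (abs_max_sub_max_le_abs _ _ _).trans (h x y hx)⟩

lemma comp_of_lipschitz {f : ℝ → ℝ} (hw : LocLip w) {M L : ℝ} (hL : 0 ≤ L)
    (hM : ∀ x, |w x| ≤ M)
    (hf : ∀ a b, |a| ≤ M → |b| ≤ M → |f a - f b| ≤ L * |a - b|) : LocLip (fun x => f (w x)) := by
  intro R
  obtain ⟨C, hC, h⟩ := hw R
  refine ⟨L * C, by positivity, fun x y hx => (hf _ _ (hM x) (hM y)).trans ?_⟩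
  rw [mul_assoc]
  exact mul_le_mul_of_nonneg_left (h x y hx) hL

/-- A locally Lipschitz function vanishing outside a ball divided by a positive one. -/
lemma div_of_support (hu : LocLip u) (hw : LocLip w) (hpos : ∀ x, 0 < w x) {R : ℝ}
    (hsupp : ∀ x, R < ‖x‖ → u x = 0) : LocLip (fun x => u x / w x) := by
  obtain ⟨c, hc, hcw⟩ : ∃ c, 0 < c ∧ ∀ x, ‖x‖ ≤ R → c ≤ w x := by
    by_cases hR : (closedBall (0 : Plane) R).Nonempty
    · obtain ⟨x₀, -, h⟩ := (isCompact_closedBall (0 : Plane) R).exists_isMinOn hR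
        hw.continuous.continuousOn
      exact ⟨w x₀, hpos _, fun x hx => h (by simpa using hx)⟩
    · refine ⟨1, one_pos, fun x hx => absurd ⟨x, by simpa using hx⟩ hR⟩
  have h := hu.mul ((hw.max_const c).inv hc (fun x => le_max_right _ _))
  convert h using 2 with x
  rcases le_or_gt ‖x‖ R with hx | hx
  · rw [max_eq_left (hcw x hx), div_eq_mul_inv]
  · simp [hsupp x hx]

lemma support_bound (hu : LocLip u) {R : ℝ} (hsupp : ∀ x, R < ‖x‖ → u x = 0) :
    ∃ C, 0 ≤ C ∧ ∀ x y, |u x - u y| ≤ C * min 1 ‖x - y‖ *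
      ((closedBall (0 : Plane) R).indicator 1 x + (closedBall (0 : Plane) R).indicator 1 y) := by
  obtain ⟨C, hC, h⟩ := hu R
  have key : ∀ x y, ‖x‖ ≤ R → |u x - u y| ≤ C * min 1 ‖x - y‖ *
      ((closedBall (0 : Plane) R).indicator 1 x + (closedBall (0 : Plane) R).indicator 1 y) := by
    intro x y hx
    refine (h x y hx).trans (le_mul_of_one_le_right (by positivity) ?_)
    have : (closedBall (0 : Plane) R).indicator (1 : Plane → ℝ) x = 1 :=
      indicator_of_mem (by simpa using hx) _
    rw [this]
    linarith [indicator_one_nonneg (closedBall (0 : Plane) R) y]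
  refine ⟨C, hC, fun x y => ?_⟩
  rcases le_or_gt ‖x‖ R with hx | hx
  · exact key x y hx
  rcases le_or_gt ‖y‖ R with hy | hy
  · rw [abs_sub_comm, norm_sub_rev, add_comm]
    exact key y x hy
  · rw [hsupp x hx, hsupp y hy]
    have := indicator_one_nonneg (closedBall (0 : Plane) R) x
    have := indicator_one_nonneg (closedBall (0 : Plane) R) y
    simp only [sub_self, abs_zero]
    positivity

end LocLip

lemma abs_diff_le {w : Plane → ℝ} {M : ℝ} (hM : ∀ x, |w x| ≤ M) (x y : Plane) :
    |w x - w y| ≤ 2 * M := by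
  have := abs_sub (w x) (w y)
  linarith [hM x, hM y]

/-- The integrand of the bilinear form associated with the kernel. -/
def formIntegrand (s : ℝ) (w u : Plane → ℝ) (p : Plane × Plane) : ℝ :=
  (w p.1 - w p.2) * (u p.1 - u p.2) * kernel s (p.1 - p.2)

/-- The bilinear form associated with the kernel. -/
def form (s : ℝ) (w u : Plane → ℝ) : ℝ := ∫ p, formIntegrand s w u p

lemma formIntegrand_bound {w u : Plane → ℝ} (s : ℝ) (hw : LocLip w) (hu : LocLip u) {R : ℝ}
    (hsupp : ∀ x, R < ‖x‖ → u x = 0) :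
    ∃ C, 0 ≤ C ∧ ∀ p, |formIntegrand s w u p| ≤ C * dominator s R p := by
  obtain ⟨C, hC, h⟩ := hw R
  obtain ⟨D, hD, h'⟩ := hu.support_bound hsupp
  refine ⟨C * D, by positivity, fun p => ?_⟩
  obtain ⟨x, y⟩ := p
  by_cases hxy : R < ‖x‖ ∧ R < ‖y‖
  · simp only [formIntegrand, hsupp x hxy.1, hsupp y hxy.2, sub_self, mul_zero, zero_mul, abs_zero]
    exact mul_nonneg (by positivity) (dominator_nonneg _ _ _)
  have hwxy : |w x - w y| ≤ C * min 1 ‖x - y‖ := by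
    rcases le_or_gt ‖x‖ R with hx | hx
    · exact h x y hx
    · have hy : ‖y‖ ≤ R := not_lt.1 fun hy => hxy ⟨hx, hy⟩
      rw [abs_sub_comm, norm_sub_rev]
      exact h y x hy
  simp only [formIntegrand, dominator, tamed, abs_mul, abs_of_nonneg (kernel_nonneg s (x - y))]
  have := mul_le_mul hwxy (h' x y) (abs_nonneg _) (by positivity)
  have := mul_le_mul_of_nonneg_right this (kernel_nonneg s (x - y))
  calc _ ≤ _ := this
    _ = _ := by ring

lemma measurable_formIntegrand {w u : Plane → ℝ} (s : ℝ) (hw : LocLip w) (hu : LocLip u) :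
    Measurable (formIntegrand s w u) := by
  have := hw.continuous.measurable
  have := hu.continuous.measurable
  unfold formIntegrand; fun_prop

lemma integrable_of_dominator {s R C : ℝ} (hs : s ∈ Ioo (0 : ℝ) 1) {F : Plane × Plane → ℝ}
    (hm : Measurable F) (hF : ∀ p, |F p| ≤ C * dominator s R p) : Integrable F :=
  ((dominator_integrable hs R).1.const_mul C).mono' hm.aestronglyMeasurable (ae_of_all _ hF)

lemma integrable_formIntegrand {s : ℝ} (hs : s ∈ Ioo (0 : ℝ) 1) {w u : Plane → ℝ}
    (hw : LocLip w) (hu : LocLip u) {R : ℝ} (hsupp : ∀ x, R < ‖x‖ → u x = 0) :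
    Integrable (formIntegrand s w u) := by
  obtain ⟨C, -, h⟩ := formIntegrand_bound s hw hu hsupp
  exact integrable_of_dominator hs (measurable_formIntegrand s hw hu) h

lemma second_difference_bound {v : Plane → ℝ} (hb : ∃ M : ℝ, ∀ y, |v y| ≤ M)
    (hv : ContDiff ℝ 2 v) (R : ℝ) :
    ∃ C, 0 ≤ C ∧ ∀ x z, ‖x‖ ≤ R → |2 * v x - v (x + z) - v (x - z)| ≤ C * min 1 ‖z‖ ^ 2 := by
  obtain ⟨M, hM⟩ := hb
  have hM0 : 0 ≤ M := (abs_nonneg _).trans (hM 0)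
  have hd : ContDiff ℝ 1 (fderiv ℝ v) := hv.fderiv_right (by norm_num)
  obtain ⟨D, hD⟩ := (isCompact_closedBall (0 : Plane) (R + 1)).exists_bound_of_continuousOn
    (hd.continuous_fderiv one_ne_zero).continuousOn
  refine ⟨max (4 * M) (2 * D), le_max_of_le_left (by positivity), fun x z hx => ?_⟩
  rcases le_total ‖z‖ 1 with h | h
  · rw [min_eq_right h]
    have hmem : ∀ y ∈ closedBall x ‖z‖, y ∈ closedBall (0 : Plane) (R + 1) := by
      intro y hy
      rw [mem_closedBall, dist_eq_norm] at hy
      have := norm_sub_norm_le y x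
      simp; linarith
    have hD0 : 0 ≤ D := (norm_nonneg _).trans (hD x (by simp; linarith))
    have hlip : ∀ y ∈ closedBall x ‖z‖, ‖fderiv ℝ v y - fderiv ℝ v x‖ ≤ D * ‖z‖ := by
      intro y hy
      have h1 := (convex_closedBall (0 : Plane) (R + 1)).norm_image_sub_le_of_norm_fderiv_le
        (fun z _ => hd.differentiable one_ne_zero z) hD (hmem x (by simp)) (hmem y hy)
      rw [mem_closedBall, dist_eq_norm] at hy
      exact h1.trans (mul_le_mul_of_nonneg_left hy hD0)
    have key : ∀ a : Plane, ‖a‖ = ‖z‖ → |v (x + a) - v x - fderiv ℝ v x a| ≤ D * ‖z‖ * ‖z‖ := by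
      intro a ha
      have := (convex_closedBall x ‖z‖).norm_image_sub_le_of_norm_fderiv_le' (f := v)
        (fun z _ => hv.differentiable two_ne_zero z) hlip (x := x) (y := x + a) (by simp)
        (by simp [ha])
      simpa [ha] using this
    have k1 := key z rfl
    have k2 := key (-z) (norm_neg z)
    rw [map_neg, ← sub_eq_add_neg] at k2
    have e : 2 * v x - v (x + z) - v (x - z) = -(v (x + z) - v x - fderiv ℝ v x z)
      - (v (x - z) - v x - -(fderiv ℝ v x z)) := by ring
    rw [e]
    have := abs_sub (-(v (x + z) - v x - fderiv ℝ v x z)) (v (x - z) - v x - -(fderiv ℝ v x z))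
    rw [abs_neg] at this
    have h3 : 2 * D * ‖z‖ ^ 2 ≤ max (4 * M) (2 * D) * ‖z‖ ^ 2 :=
      mul_le_mul_of_nonneg_right (le_max_right _ _) (by positivity)
    nlinarith
  · rw [min_eq_left h, one_pow, mul_one]
    refine le_max_of_le_left ?_
    have := abs_le.1 (hM x)
    have := abs_le.1 (hM (x + z))
    have := abs_le.1 (hM (x - z))
    rw [abs_le]; constructor <;> linarith

/-- The kernel truncated near the origin. -/
def truncated (s ε : ℝ) (z : Plane) : ℝ := {z : Plane | ε ≤ ‖z‖}.indicator (kernel s) z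

lemma measurableSet_far (ε : ℝ) : MeasurableSet {z : Plane | ε ≤ ‖z‖} :=
  measurableSet_le measurable_const measurable_norm

@[fun_prop]
lemma measurable_truncated (s ε : ℝ) : Measurable (truncated s ε) :=
  (measurable_kernel s).indicator (measurableSet_far ε)

lemma truncated_nonneg (s ε : ℝ) (z : Plane) : 0 ≤ truncated s ε z :=
  indicator_nonneg (fun _ _ => kernel_nonneg s _) z

lemma truncated_le (s ε : ℝ) (z : Plane) : truncated s ε z ≤ kernel s z :=
  indicator_le_self' (fun _ _ => kernel_nonneg s _) z

lemma truncated_neg (s ε : ℝ) (z : Plane) : truncated s ε (-z) = truncated s ε z := by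
  simp only [truncated, indicator, mem_ofPred_eq, norm_neg, kernel_neg]

lemma integrable_truncated {s ε : ℝ} (hs : s ∈ Ioo (0 : ℝ) 1) (hε : 0 < ε) :
    Integrable (truncated s ε) := by
  have hpos : 0 < min 1 ε := lt_min one_pos hε
  refine ((integrable_tamed hs).const_mul ((min 1 ε ^ 2)⁻¹)).mono'
    (measurable_truncated s ε).aestronglyMeasurable (ae_of_all _ fun z => ?_)
  rw [Real.norm_of_nonneg (truncated_nonneg s ε z)]
  by_cases hz : ε ≤ ‖z‖
  · rw [truncated, indicator_of_mem (by exact hz), tamed, ← mul_assoc]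
    refine le_mul_of_one_le_left (kernel_nonneg s z) ?_
    rw [← div_eq_inv_mul, one_le_div (by positivity)]
    gcongr
  · rw [truncated, indicator_of_notMem (by exact hz)]
    exact mul_nonneg (by positivity) (tamed_nonneg s z)

/-- The truncated fractional Laplacian. -/
def truncLap (s ε : ℝ) (v : Plane → ℝ) (x : Plane) : ℝ :=
  ∫ y, (v x - v y) * truncated s ε (x - y)

lemma truncLap_eq (s ε : ℝ) (v : Plane → ℝ) (x : Plane) :
    truncLap s ε v x = ∫ z in {z : Plane | ε ≤ dist z x}, (v x - v z) / dist x z ^ (2 + 2 * s) := by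
  rw [truncLap, ← integral_indicator (measurableSet_le measurable_const (by fun_prop))]
  congr 1
  ext y
  by_cases h : ε ≤ dist y x
  · rw [indicator_of_mem (by exact h), truncated, indicator_of_mem, kernel, ← dist_eq_norm,
      div_eq_mul_inv]
    simpa [← dist_eq_norm, dist_comm] using h
  · rw [indicator_of_notMem (by exact h), truncated, indicator_of_notMem, mul_zero]
    simpa [← dist_eq_norm, dist_comm] using h

lemma integrable_diff_truncated {s ε M : ℝ} (hs : s ∈ Ioo (0 : ℝ) 1) (hε : 0 < ε)
    {u : Plane → ℝ} (hu : Continuous u) (hM : ∀ z, |u z| ≤ M) :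
    Integrable (fun z => u z * truncated s ε z) :=
  (integrable_truncated hs hε).bdd_mul hu.aestronglyMeasurable (ae_of_all _ hM)

lemma truncLap_bound {s : ℝ} (hs : s ∈ Ioo (0 : ℝ) 1) {v : Plane → ℝ}
    (hb : ∃ M : ℝ, ∀ y, |v y| ≤ M) (hv : ContDiff ℝ 2 v) (R : ℝ) :
    ∃ C, 0 ≤ C ∧ ∀ ε > 0, ∀ x, ‖x‖ ≤ R → |truncLap s ε v x| ≤ C := by
  obtain ⟨C, hC, h⟩ := second_difference_bound hb hv R
  obtain ⟨M, hM⟩ := hb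
  have hcont := hv.continuous
  refine ⟨2⁻¹ * (C * ∫ z, tamed s z), mul_nonneg (by norm_num)
    (mul_nonneg hC (integral_nonneg (tamed_nonneg s))), fun ε hε x hx => ?_⟩
  have e1 : truncLap s ε v x = ∫ z, (v x - v (x + z)) * truncated s ε z := by
    rw [truncLap, ← integral_add_left_eq_self _ x]
    congr 1; ext z
    rw [sub_add_cancel_left, truncated_neg]
  have e2 : truncLap s ε v x = ∫ z, (v x - v (x - z)) * truncated s ε z := by
    rw [e1, ← integral_neg_eq_self]
    congr 1; ext z
    rw [truncated_neg, ← sub_eq_add_neg]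
  have i1 : Integrable (fun z => (v x - v (x + z)) * truncated s ε z) :=
    integrable_diff_truncated hs hε (by fun_prop) (fun z => abs_diff_le hM _ _)
  have i2 : Integrable (fun z => (v x - v (x - z)) * truncated s ε z) :=
    integrable_diff_truncated hs hε (by fun_prop) (fun z => abs_diff_le hM _ _)
  have e3 : truncLap s ε v x
      = 2⁻¹ * ∫ z, (2 * v x - v (x + z) - v (x - z)) * truncated s ε z := by
    have : ∫ z, (2 * v x - v (x + z) - v (x - z)) * truncated s ε z
        = truncLap s ε v x + truncLap s ε v x := by
      nth_rewrite 1 [e1]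
      rw [e2, ← integral_add i1 i2]
      congr 1; ext z; ring
    rw [this]; ring
  rw [e3, abs_mul, abs_of_pos (by norm_num : (0 : ℝ) < 2⁻¹)]
  refine mul_le_mul_of_nonneg_left ?_ (by norm_num)
  rw [← integral_const_mul, ← Real.norm_eq_abs]
  refine norm_integral_le_of_norm_le ((integrable_tamed hs).const_mul C) (ae_of_all _ fun z => ?_)
  rw [Real.norm_eq_abs, abs_mul, abs_of_nonneg (truncated_nonneg s ε z), tamed, ← mul_assoc]
  exact mul_le_mul (h x z hx) (truncated_le s ε z) (truncated_nonneg s ε z) (by positivity)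

/-- Functions with the pointwise principal value equation `(-Δ)^s v = g`. -/
def Solves (s : ℝ) (v g : Plane → ℝ) : Prop :=
  ∀ x, Tendsto (fun ε => truncLap s ε v x) (𝓝[>] 0) (𝓝 (g x))

lemma truncated_form_eq {s ε : ℝ} (hs : s ∈ Ioo (0 : ℝ) 1) (hε : 0 < ε) {v η : Plane → ℝ}
    (hv : LocLip v) (hη : LocLip η) (hi : Integrable η) :
    ∫ p : Plane × Plane, (v p.1 - v p.2) * (η p.1 - η p.2) * truncated s ε (p.1 - p.2)
      = 2 * ∫ x, truncLap s ε v x * η x := by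
  obtain ⟨M, hM0, hM⟩ := hv.bounded
  have hvm := hv.continuous.measurable
  have hηm := hη.continuous.measurable
  set H : Plane × Plane → ℝ := fun p =>
    (v p.1 - v p.2) * (η p.1 * truncated s ε (p.1 - p.2)) with hH
  have iH : Integrable H := by
    refine (integrable_prod_sub hi (integrable_truncated hs hε)).1.bdd_mul (c := 2 * M)
      (Measurable.aestronglyMeasurable (by fun_prop)) (ae_of_all _ fun p => ?_)
    exact abs_diff_le hM _ _
  have iH' : Integrable (fun p : Plane × Plane => H p.swap) :=
    measurePreserving_swap_plane.integrable_comp_of_integrable iH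
  have e : (fun p : Plane × Plane =>
      (v p.1 - v p.2) * (η p.1 - η p.2) * truncated s ε (p.1 - p.2))
      = fun p => H p + H p.swap := by
    ext p
    have : truncated s ε (p.2 - p.1) = truncated s ε (p.1 - p.2) := by
      rw [← truncated_neg, neg_sub]
    simp only [hH, Prod.fst_swap, Prod.snd_swap, this]
    ring
  rw [e, integral_add iH iH', integral_swap (F := H), ← two_mul]
  congr 1
  rw [Measure.volume_eq_prod, integral_prod _ (by rwa [← Measure.volume_eq_prod])]
  congr 1; ext x
  rw [truncLap, ← integral_mul_const]
  congr 1; ext y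
  simp only [hH]; ring

lemma integrable_of_support {η : Plane → ℝ} (hη : LocLip η) {R : ℝ}
    (hsupp : ∀ x, R < ‖x‖ → η x = 0) : Integrable η :=
  hη.continuous.integrable_of_hasCompactSupport
    (HasCompactSupport.intro (isCompact_closedBall (0 : Plane) R)
      fun x hx => hsupp x (by simpa using hx))

lemma Solves.weak {s : ℝ} (hs : s ∈ Ioo (0 : ℝ) 1) {v g : Plane → ℝ}
    (hb : ∃ M : ℝ, ∀ y, |v y| ≤ M) (hv : ContDiff ℝ 2 v) (h : Solves s v g) {η : Plane → ℝ}
    (hη : LocLip η) {R : ℝ} (hsupp : ∀ x, R < ‖x‖ → η x = 0) :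
    form s v η = 2 * ∫ x, g x * η x := by
  have hvL : LocLip v := LocLip.of_contDiff hb (hv.of_le (by norm_num))
  have hi := integrable_of_support hη hsupp
  obtain ⟨C, hC, hCb⟩ := truncLap_bound hs hb hv R
  have hvm := hvL.continuous.measurable
  have hηm := hη.continuous.measurable
  have lim1 : Tendsto (fun ε => ∫ x, truncLap s ε v x * η x) (𝓝[>] 0) (𝓝 (∫ x, g x * η x)) := by
    refine tendsto_integral_filter_of_dominated_convergence (fun x => C * |η x|) ?_ ?_
      (hi.abs.const_mul C) (ae_of_all _ fun x => (h x).mul_const _)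
    · refine Eventually.of_forall fun ε => AEStronglyMeasurable.mul ?_ hi.aestronglyMeasurable
      refine StronglyMeasurable.aestronglyMeasurable ?_
      unfold truncLap
      refine StronglyMeasurable.integral_prod_right'
        (f := fun p : Plane × Plane => (v p.1 - v p.2) * truncated s ε (p.1 - p.2)) ?_
      exact Measurable.stronglyMeasurable (by fun_prop)
    · filter_upwards [self_mem_nhdsWithin] with ε hε
      refine ae_of_all _ fun x => ?_
      rw [Real.norm_eq_abs, abs_mul]
      rcases le_or_gt ‖x‖ R with hx | hx
      · exact mul_le_mul_of_nonneg_right (hCb ε hε x hx) (abs_nonneg _)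
      · simp [hsupp x hx]
  obtain ⟨D, hD, hDb⟩ := formIntegrand_bound s hvL hη hsupp
  have lim2 : Tendsto (fun ε => ∫ p : Plane × Plane,
      (v p.1 - v p.2) * (η p.1 - η p.2) * truncated s ε (p.1 - p.2)) (𝓝[>] 0)
      (𝓝 (form s v η)) := by
    refine tendsto_integral_filter_of_dominated_convergence (fun p => D * dominator s R p) ?_ ?_
      ((dominator_integrable hs R).1.const_mul D) (ae_of_all _ fun p => ?_)
    · exact Eventually.of_forall fun ε => Measurable.aestronglyMeasurable (by fun_prop)
    · refine Eventually.of_forall fun ε => ae_of_all _ fun p => ?_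
      refine le_trans ?_ (hDb p)
      rw [Real.norm_eq_abs, formIntegrand, abs_mul, abs_mul (_ * _) (kernel s _),
        abs_of_nonneg (truncated_nonneg _ _ _), abs_of_nonneg (kernel_nonneg _ _)]
      exact mul_le_mul_of_nonneg_left (truncated_le _ _ _) (abs_nonneg _)
    · by_cases hp : p.1 = p.2
      · simp [formIntegrand, hp]
      · have hp' : 0 < ‖p.1 - p.2‖ := norm_pos_iff.2 (sub_ne_zero.2 hp)
        refine tendsto_const_nhds.congr' ?_
        filter_upwards [Ioo_mem_nhdsGT hp'] with ε hε
        rw [formIntegrand, truncated, indicator_of_mem]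
        exact hε.2.le
  refine tendsto_nhds_unique lim2 ((lim1.const_mul 2).congr' ?_)
  filter_upwards [self_mem_nhdsWithin] with ε hε
  exact (truncated_form_eq hs hε hvL hη hi).symm

lemma Solves.comp_add {s : ℝ} {v g : Plane → ℝ} (h : Solves s v g) (a : Plane) :
    Solves s (fun x => v (x + a)) (fun x => g (x + a)) := by
  intro x
  refine (h (x + a)).congr fun ε => ?_
  rw [truncLap, truncLap, ← integral_add_right_eq_self _ a]
  simp

lemma Solves.weak_diff {s : ℝ} (hs : s ∈ Ioo (0 : ℝ) 1) {v g : Plane → ℝ}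
    (hb : ∃ M : ℝ, ∀ y, |v y| ≤ M) (hv : ContDiff ℝ 2 v) (h : Solves s v g) (hg : LocLip g)
    (a : Plane) {η : Plane → ℝ} (hη : LocLip η) {R : ℝ} (hsupp : ∀ x, R < ‖x‖ → η x = 0) :
    form s (fun x => v (x + a) - v x) η = 2 * ∫ x, (g (x + a) - g x) * η x := by
  have hvL : LocLip v := LocLip.of_contDiff hb (hv.of_le (by norm_num))
  obtain ⟨M, hM⟩ := hb
  have hva : ContDiff ℝ 2 (fun x => v (x + a)) := hv.comp (contDiff_id.add contDiff_const)
  have h1 := (h.comp_add a).weak hs ⟨M, fun y => hM _⟩ hva hη hsupp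
  have h2 := h.weak hs ⟨M, hM⟩ hv hη hsupp
  have i := integrable_of_support hη hsupp
  have ig : ∀ {u : Plane → ℝ}, LocLip u → Integrable fun x => u x * η x := by
    intro u hu
    obtain ⟨N, -, hN⟩ := hu.bounded
    exact i.bdd_mul hu.continuous.aestronglyMeasurable (ae_of_all _ hN)
  have e : form s (fun x => v (x + a) - v x) η
      = form s (fun x => v (x + a)) η - form s v η := by
    rw [form, form, form, ← integral_sub (integrable_formIntegrand hs (hvL.comp_add a) hη hsupp)
      (integrable_formIntegrand hs hvL hη hsupp)]
    congr 1; ext p; simp only [formIntegrand]; ring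
  rw [e, h1, h2, ← mul_sub, ← integral_sub (ig (hg.comp_add a)) (ig hg)]
  congr 2; ext x; ring

/-- Truncation of a real number to the unit interval. -/
def clamp (t : ℝ) : ℝ := max 0 (min 1 t)

lemma clamp_nonneg (t : ℝ) : 0 ≤ clamp t := le_max_left _ _

lemma clamp_le_one (t : ℝ) : clamp t ≤ 1 := max_le zero_le_one (min_le_left _ _)

lemma clamp_of_one_le {t : ℝ} (h : 1 ≤ t) : clamp t = 1 := by simp [clamp, h]

lemma clamp_of_nonpos {t : ℝ} (h : t ≤ 0) : clamp t = 0 := by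
  simp [clamp, h]

lemma abs_clamp_sub_le (a b : ℝ) : |clamp a - clamp b| ≤ |a - b| := by
  have h1 := abs_max_sub_max_le_abs (min 1 a) (min 1 b) 0
  have h2 := abs_min_sub_min_le_max 1 a 1 b
  simp only [sub_self, abs_zero, max_eq_right (abs_nonneg (a - b))] at h2
  rw [clamp, clamp, max_comm 0, max_comm 0]
  exact h1.trans h2

lemma abs_clamp_sub_le_one (a b : ℝ) : |clamp a - clamp b| ≤ 1 := by
  rw [abs_le]
  constructor <;> linarith [clamp_nonneg a, clamp_nonneg b, clamp_le_one a, clamp_le_one b]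

/-- Cutoffs with values in the unit interval, supported in a ball and 1-Lipschitz. -/
structure IsCutoff (χ : Plane → ℝ) (R : ℝ) : Prop where
  supp : ∀ x, R < ‖x‖ → χ x = 0
  nonneg : ∀ x, 0 ≤ χ x
  le_one : ∀ x, χ x ≤ 1
  lip : ∀ x y, |χ x - χ y| ≤ min 1 ‖x - y‖

lemma IsCutoff.locLip {χ : Plane → ℝ} {R : ℝ} (h : IsCutoff χ R) : LocLip χ :=
  fun _ => ⟨1, zero_le_one, fun x y _ => by simpa using h.lip x y⟩

lemma formIntegrand_self_nonneg (s : ℝ) (w : Plane → ℝ) (p : Plane × Plane) :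
    0 ≤ formIntegrand s w w p :=
  mul_nonneg (mul_self_nonneg _) (kernel_nonneg _ _)

lemma IsCutoff.formIntegrand_le_tamed {χ : Plane → ℝ} {R : ℝ} (h : IsCutoff χ R) (s : ℝ)
    (p : Plane × Plane) : formIntegrand s χ χ p ≤ tamed s (p.1 - p.2) := by
  refine mul_le_mul_of_nonneg_right ?_ (kernel_nonneg _ _)
  rw [← sq, ← sq_abs]
  exact pow_le_pow_left₀ (abs_nonneg _) (h.lip _ _) 2

lemma IsCutoff.formIntegrand_le {χ : Plane → ℝ} {R : ℝ} (h : IsCutoff χ R) (s : ℝ)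
    (p : Plane × Plane) : formIntegrand s χ χ p ≤ dominator s R p := by
  have h1 := indicator_one_nonneg (closedBall (0 : Plane) R) p.1
  have h2 := indicator_one_nonneg (closedBall (0 : Plane) R) p.2
  by_cases hx : ‖p.1‖ ≤ R
  · have : (closedBall (0 : Plane) R).indicator (1 : Plane → ℝ) p.1 = 1 :=
      indicator_of_mem (by simpa using hx) _
    exact (h.formIntegrand_le_tamed s p).trans
      (le_mul_of_one_le_left (tamed_nonneg _ _) (by linarith))
  by_cases hy : ‖p.2‖ ≤ R
  · have : (closedBall (0 : Plane) R).indicator (1 : Plane → ℝ) p.2 = 1 :=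
      indicator_of_mem (by simpa using hy) _
    exact (h.formIntegrand_le_tamed s p).trans
      (le_mul_of_one_le_left (tamed_nonneg _ _) (by linarith))
  · rw [formIntegrand, h.supp _ (not_le.1 hx), h.supp _ (not_le.1 hy)]
    simpa using dominator_nonneg s R p

lemma integrable_mul_cutoff_form {s : ℝ} (hs : s ∈ Ioo (0 : ℝ) 1) {χ : Plane → ℝ} {R : ℝ}
    (h : IsCutoff χ R) {F : Plane × Plane → ℝ} (hF : Measurable F) {C : ℝ}
    (hC : ∀ p, |F p| ≤ C) : Integrable (fun p => F p * formIntegrand s χ χ p) :=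
  (integrable_formIntegrand hs h.locLip h.locLip h.supp).bdd_mul hF.aestronglyMeasurable
    (ae_of_all _ hC)

lemma form_cutoff_mul {s : ℝ} (hs : s ∈ Ioo (0 : ℝ) 1) {χ w : Plane → ℝ} {R : ℝ}
    (h : IsCutoff χ R) (hw : LocLip w) :
    form s (fun x => χ x * w x) (fun x => χ x * w x) =
      form s w (fun x => χ x * (χ x * w x))
        + ∫ p : Plane × Plane, w p.1 * w p.2 * formIntegrand s χ χ p := by
  obtain ⟨M, hM0, hM⟩ := hw.bounded
  have hwm := hw.continuous.measurable
  have hχ := h.locLip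
  rw [form, form, ← integral_add
    (integrable_formIntegrand hs hw (hχ.mul (hχ.mul hw)) (R := R) fun x hx => by simp [h.supp x hx])
    (integrable_mul_cutoff_form hs h (by fun_prop) (C := M * M) fun p => ?_)]
  · congr 1; ext p; simp only [formIntegrand]; ring
  · rw [abs_mul]
    exact mul_le_mul (hM _) (hM _) (abs_nonneg _) hM0

lemma indicator_mul_form_bound {s : ℝ} {v : Plane → ℝ} (hv : LocLip v) (R : ℝ) :
    ∃ C, 0 ≤ C ∧ ∀ p : Plane × Plane,
      |(closedBall (0 : Plane) R).indicator 1 p.1 * formIntegrand s v v p|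
        ≤ C * dominator s R p := by
  obtain ⟨C, hC, h⟩ := hv R
  refine ⟨C ^ 2, by positivity, fun p => ?_⟩
  by_cases hx : ‖p.1‖ ≤ R
  · have : (closedBall (0 : Plane) R).indicator (1 : Plane → ℝ) p.1 = 1 :=
      indicator_of_mem (by simpa using hx) _
    rw [this, one_mul, abs_of_nonneg (formIntegrand_self_nonneg _ _ _), dominator, this]
    have h2 := indicator_one_nonneg (closedBall (0 : Plane) R) p.2
    have h3 : formIntegrand s v v p ≤ C ^ 2 * tamed s (p.1 - p.2) := by
      rw [formIntegrand, tamed, ← mul_assoc]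
      refine mul_le_mul_of_nonneg_right ?_ (kernel_nonneg _ _)
      rw [← sq, ← sq_abs, ← mul_pow]
      exact pow_le_pow_left₀ (abs_nonneg _) (h _ _ hx) 2
    refine h3.trans (mul_le_mul_of_nonneg_left ?_ (by positivity))
    exact le_mul_of_one_le_left (tamed_nonneg _ _) (by linarith)
  · have : (closedBall (0 : Plane) R).indicator (1 : Plane → ℝ) p.1 = 0 :=
      indicator_of_notMem (by simpa using hx) _
    rw [this, zero_mul, abs_zero]
    exact mul_nonneg (by positivity) (dominator_nonneg _ _ _)

lemma integrable_indicator_mul_form {s : ℝ} (hs : s ∈ Ioo (0 : ℝ) 1) {v : Plane → ℝ}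
    (hv : LocLip v) (R : ℝ) : Integrable (fun p : Plane × Plane =>
      (closedBall (0 : Plane) R).indicator 1 p.1 * formIntegrand s v v p) := by
  obtain ⟨C, -, h⟩ := indicator_mul_form_bound (s := s) hv R
  refine integrable_of_dominator hs ?_ h
  have h1 : Measurable ((closedBall (0 : Plane) R).indicator (1 : Plane → ℝ)) :=
    measurable_one.indicator measurableSet_closedBall
  exact (h1.comp measurable_fst).mul (measurable_formIntegrand s hv hv)

/-- The cutoff equal to one on the ball of radius `R` and vanishing outside radius `R + 1`. -/
def ballCutoff (R : ℝ) (x : Plane) : ℝ := clamp (R + 1 - ‖x‖)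

lemma isCutoff_ballCutoff (R : ℝ) : IsCutoff (ballCutoff R) (R + 1) where
  supp x hx := clamp_of_nonpos (by linarith)
  nonneg x := clamp_nonneg _
  le_one x := clamp_le_one _
  lip x y := by
    refine le_min (abs_clamp_sub_le_one _ _) ((abs_clamp_sub_le _ _).trans ?_)
    rw [sub_sub_sub_cancel_left, abs_sub_comm]
    exact abs_norm_sub_norm_le x y

/-- Quadratic growth of the energy of a bounded solution. -/
lemma energy_growth {s : ℝ} (hs : s ∈ Ioo (0 : ℝ) 1) {v g : Plane → ℝ}
    (hb : ∃ M : ℝ, ∀ y, |v y| ≤ M) (hv : ContDiff ℝ 2 v) (h : Solves s v g) (hg : LocLip g) :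
    ∃ C, 0 ≤ C ∧ ∀ R, 1 ≤ R → ∫ p : Plane × Plane,
      (closedBall (0 : Plane) R).indicator 1 p.1 * formIntegrand s v v p ≤ C * R ^ 2 := by
  have hvL : LocLip v := LocLip.of_contDiff hb (hv.of_le (by norm_num))
  obtain ⟨M, hM0, hM⟩ := hvL.bounded
  obtain ⟨G, hG0, hG⟩ := hg.bounded
  obtain ⟨V, hV0, hV⟩ := volume_ball_le
  have hvm := hvL.continuous.measurable
  set T := ∫ z, tamed s z with hT
  have hT0 : 0 ≤ T := integral_nonneg (tamed_nonneg s)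
  refine ⟨2 * (G * M) * (V * 9) + (M * M) * (2 * (V * 9) * T) + 4 * M ^ 2 * (2 * V * T),
    by positivity, fun R hR => ?_⟩
  set χ := ballCutoff (R + 1) with hχ
  have hc : IsCutoff χ (R + 2) := by
    have := isCutoff_ballCutoff (R + 1)
    rwa [add_assoc, one_add_one_eq_two] at this
  have hVR : volume.real (closedBall (0 : Plane) (R + 2)) ≤ V * 9 * R ^ 2 := by
    rw [hV _ (by linarith), mul_assoc]
    refine mul_le_mul_of_nonneg_left ?_ hV0
    nlinarith
  have hsupp : ∀ x, R + 2 < ‖x‖ → χ x * (χ x * v x) = 0 := fun x hx => by simp [hc.supp x hx]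
  have hL := hc.locLip.mul (hc.locLip.mul hvL)
  have hweak := h.weak hs ⟨M, hM⟩ hv hL hsupp
  have b1 : ∫ x, g x * (χ x * (χ x * v x)) ≤ G * M * (V * 9 * R ^ 2) := by
    calc _ ≤ ∫ x, G * M * (closedBall (0 : Plane) (R + 2)).indicator 1 x := by
          refine (Real.le_norm_self _).trans (norm_integral_le_of_norm_le
            ((integrable_indicator_ball _).const_mul _) (ae_of_all _ fun x => ?_))
          rcases le_or_gt ‖x‖ (R + 2) with hx | hx
          · rw [indicator_of_mem (by simpa using hx), Pi.one_apply, mul_one, Real.norm_eq_abs,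
              abs_mul, abs_mul, abs_mul, abs_of_nonneg (hc.nonneg x)]
            refine mul_le_mul (hG x) ?_ (by have := hc.nonneg x; positivity) hG0
            have h1 := hc.le_one x
            have h0 := hc.nonneg x
            calc χ x * (χ x * |v x|) ≤ 1 * (1 * |v x|) := by gcongr
              _ ≤ M := by simpa using hM x
          · rw [hsupp x hx, mul_zero, norm_zero]
            exact mul_nonneg (by positivity) (indicator_one_nonneg _ _)
      _ ≤ _ := by
          rw [integral_const_mul, integral_indicator_ball]
          gcongr
  have b2 : ∫ p : Plane × Plane, v p.1 * v p.2 * formIntegrand s χ χ p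
      ≤ M * M * (2 * (V * 9 * R ^ 2) * T) := by
    calc _ ≤ ∫ p, M * M * dominator s (R + 2) p := by
          refine integral_mono (integrable_mul_cutoff_form hs hc (by fun_prop) (C := M * M)
            fun p => ?_) ((dominator_integrable hs _).1.const_mul _) fun p => ?_
          · rw [abs_mul]
            exact mul_le_mul (hM _) (hM _) (abs_nonneg _) hM0
          · refine mul_le_mul ?_ (hc.formIntegrand_le s p) (formIntegrand_self_nonneg _ _ _)
              (by positivity)
            refine (le_abs_self _).trans ?_
            rw [abs_mul]
            exact mul_le_mul (hM _) (hM _) (abs_nonneg _) hM0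
      _ ≤ _ := by
          rw [integral_const_mul, (dominator_integrable hs _).2]
          gcongr
  have b3 := form_cutoff_mul hs hc hvL
  have hcv := hc.locLip.mul hvL
  have hcvs : ∀ x, R + 2 < ‖x‖ → χ x * v x = 0 := fun x hx => by simp [hc.supp x hx]
  calc _ ≤ ∫ p, (formIntegrand s (fun x => χ x * v x) (fun x => χ x * v x) p
          + 4 * M ^ 2 * dominator s R p) := by
        refine integral_mono (integrable_indicator_mul_form hs hvL R)
          ((integrable_formIntegrand hs hcv hcv hcvs).add
            ((dominator_integrable hs _).1.const_mul _)) fun p => ?_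
        have n1 := formIntegrand_self_nonneg s (fun x => χ x * v x) p
        have n2 := mul_nonneg (by positivity : 0 ≤ 4 * M ^ 2) (dominator_nonneg s R p)
        by_cases hx : ‖p.1‖ ≤ R
        · have e1 : (closedBall (0 : Plane) R).indicator (1 : Plane → ℝ) p.1 = 1 :=
            indicator_of_mem (by simpa using hx) _
          simp only [e1, one_mul]
          rcases le_total ‖p.1 - p.2‖ 1 with hp | hp
          · have hy : ‖p.2‖ ≤ R + 1 := by
              have := norm_sub_norm_le p.2 p.1
              rw [norm_sub_rev] at this
              linarith
            have c1 : χ p.1 = 1 := clamp_of_one_le (by linarith)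
            have c2 : χ p.2 = 1 := clamp_of_one_le (by linarith)
            have : formIntegrand s (fun x => χ x * v x) (fun x => χ x * v x) p
                = formIntegrand s v v p := by simp [formIntegrand, c1, c2]
            linarith
          · have h2 := indicator_one_nonneg (closedBall (0 : Plane) R) p.2
            have h3 : formIntegrand s v v p ≤ 4 * M ^ 2 * tamed s (p.1 - p.2) := by
              rw [formIntegrand, tamed, min_eq_left hp, one_pow, one_mul]
              refine mul_le_mul_of_nonneg_right ?_ (kernel_nonneg _ _)
              have := pow_le_pow_left₀ (abs_nonneg _) (abs_diff_le hM p.1 p.2) 2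
              rw [sq_abs] at this
              nlinarith
            have h4 : tamed s (p.1 - p.2) ≤ dominator s R p := by
              rw [dominator, e1]
              exact le_mul_of_one_le_left (tamed_nonneg _ _) (by linarith)
            have h5 := mul_le_mul_of_nonneg_left h4 (by positivity : 0 ≤ 4 * M ^ 2)
            linarith
        · have e1 : (closedBall (0 : Plane) R).indicator (1 : Plane → ℝ) p.1 = 0 :=
            indicator_of_notMem (by simpa using hx) _
          simp only [e1, zero_mul]
          linarith
    _ = form s (fun x => χ x * v x) (fun x => χ x * v x)
          + 4 * M ^ 2 * (2 * (V * R ^ 2) * T) := by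
        rw [integral_add (integrable_formIntegrand hs hcv hcv hcvs)
            ((dominator_integrable hs _).1.const_mul _), integral_const_mul,
            (dominator_integrable hs _).2, hV _ (by linarith), form]
    _ ≤ _ := by
        rw [b3, hweak]
        linarith

lemma rpow_one_add_expansion {α : ℝ} (hα : 0 < α) : ∃ C, 0 ≤ C ∧ ∀ x ∈ Icc (-(3 / 4) : ℝ) (5 / 4),
    |(1 + x) ^ (-α) - 1| ≤ C * |x| ∧ |(1 + x) ^ (-α) - 1 + α * x| ≤ C * x ^ 2 := by
  have lip : ∀ β : ℝ, ∃ C, 0 ≤ C ∧ ∀ x ∈ Icc (-(3 / 4) : ℝ) (5 / 4),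
      |(1 + x) ^ β - 1| ≤ C * |x| := by
    intro β
    have hd : ∀ x ∈ Icc (-(3 / 4) : ℝ) (5 / 4),
        HasDerivAt (fun x : ℝ => (1 + x) ^ β) (1 * β * (1 + x) ^ (β - 1)) x := fun x hx =>
      ((hasDerivAt_id x).const_add 1).rpow_const (Or.inl (by have := hx.1; simp; linarith))
    have hc : ContinuousOn (fun x : ℝ => 1 * β * (1 + x) ^ (β - 1)) (Icc (-(3 / 4)) (5 / 4)) := by
      refine continuousOn_const.mul (ContinuousOn.rpow_const (by fun_prop) fun x hx => Or.inl ?_)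
      have := hx.1
      linarith
    obtain ⟨C, hC⟩ := isCompact_Icc.exists_bound_of_continuousOn hc
    refine ⟨C, (norm_nonneg _).trans (hC 0 (by norm_num)), fun x hx => ?_⟩
    have := (convex_Icc (-(3 / 4) : ℝ) (5 / 4)).norm_image_sub_le_of_norm_hasDerivWithin_le
      (fun x hx => (hd x hx).hasDerivWithinAt) hC (x := 0) (y := x) (by norm_num) hx
    simpa using this
  obtain ⟨C₁, hC₁, h₁⟩ := lip (-α)
  obtain ⟨C₂, hC₂, h₂⟩ := lip (-α - 1)
  refine ⟨max C₁ (α * C₂), le_max_of_le_left hC₁, fun x hx => ⟨(h₁ x hx).trans ?_, ?_⟩⟩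
  · exact mul_le_mul_of_nonneg_right (le_max_left _ _) (abs_nonneg _)
  have hsub : uIcc 0 x ⊆ Icc (-(3 / 4) : ℝ) (5 / 4) :=
    uIcc_subset_Icc (by norm_num) hx
  have hd : ∀ y ∈ uIcc 0 x, HasDerivWithinAt (fun x : ℝ => (1 + x) ^ (-α) - 1 + α * x)
      (1 * (-α) * (1 + y) ^ (-α - 1) + α * 1) (uIcc 0 x) y := by
    intro y hy
    have hy1 := (hsub hy).1
    have := ((hasDerivAt_id y).const_add 1).rpow_const (p := -α)
      (Or.inl (by simp; linarith))
    exact ((this.sub_const 1).add ((hasDerivAt_id y).const_mul α)).hasDerivWithinAt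
  have hb : ∀ y ∈ uIcc 0 x, ‖1 * (-α) * (1 + y) ^ (-α - 1) + α * 1‖ ≤ α * C₂ * |x| := by
    intro y hy
    have e : 1 * (-α) * (1 + y) ^ (-α - 1) + α * 1 = -α * ((1 + y) ^ (-α - 1) - 1) := by ring
    rw [e, norm_mul, norm_neg, Real.norm_of_nonneg hα.le, mul_assoc]
    refine mul_le_mul_of_nonneg_left ((h₂ y (hsub hy)).trans ?_) hα.le
    refine mul_le_mul_of_nonneg_left ?_ hC₂
    have := abs_sub_left_of_mem_uIcc hy
    simpa using this
  have := (convex_uIcc 0 x).norm_image_sub_le_of_norm_hasDerivWithin_le hd hb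
    left_mem_uIcc right_mem_uIcc
  simp only [Real.norm_eq_abs, add_zero, Real.one_rpow, mul_zero, sub_zero, sub_self] at this
  refine this.trans ?_
  rw [mul_assoc, ← sq, sq_abs]
  exact mul_le_mul_of_nonneg_right (le_max_right _ _) (sq_nonneg _)

lemma kernel_eq_rpow (s : ℝ) (z : Plane) : kernel s z = (‖z‖ ^ 2) ^ (-(1 + s)) := by
  rw [kernel, Real.rpow_neg (by positivity), ← Real.rpow_natCast, ← Real.rpow_mul (norm_nonneg _)]
  congr 2; push_cast; ring

lemma kernel_difference_bounds {s : ℝ} (hs : s ∈ Ioo (0 : ℝ) 1) : ∃ C, 0 ≤ C ∧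
    ∀ d h : Plane, d ≠ 0 → 2 * ‖h‖ ≤ ‖d‖ →
      |kernel s (d + h) - kernel s (d - h)| ≤ C * kernel s d * (‖h‖ / ‖d‖) ∧
      |kernel s (d + h) + kernel s (d - h) - 2 * kernel s d|
        ≤ C * kernel s d * (‖h‖ / ‖d‖) ^ 2 := by
  have hα : 0 < 1 + s := by linarith [hs.1]
  obtain ⟨C, hC, hexp⟩ := rpow_one_add_expansion hα
  refine ⟨5 * C + (2 * (1 + s) + 13 * C), by positivity, fun d h hd hh => ?_⟩
  have hd0 : 0 < ‖d‖ := norm_pos_iff.2 hd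
  set r := ‖h‖ / ‖d‖ with hr
  have hr0 : 0 ≤ r := by positivity
  have hr1 : r ≤ 1 / 2 := by rw [hr, div_le_div_iff₀ hd0 two_pos]; linarith
  set i := ⟪d, h⟫ / ‖d‖ ^ 2 with hi
  have hir : |i| ≤ r := by
    rw [hi, abs_div, abs_of_pos (by positivity : 0 < ‖d‖ ^ 2), hr, div_le_div_iff₀ (by positivity) hd0]
    have := abs_real_inner_le_norm d h
    nlinarith
  obtain ⟨hi1, hi2⟩ := abs_le.1 hir
  have hK := kernel_nonneg s d
  have key : ∀ e : Plane, ∀ j : ℝ, ‖e‖ = ‖h‖ → ⟪d, e⟫ / ‖d‖ ^ 2 = j → |j| ≤ r →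
      kernel s (d + e) = kernel s d * (1 + (2 * j + r ^ 2)) ^ (-(1 + s)) := by
    intro e j he hj hjr
    obtain ⟨hj1, hj2⟩ := abs_le.1 hjr
    have e1 : ‖d + e‖ ^ 2 = ‖d‖ ^ 2 * (1 + (2 * j + r ^ 2)) := by
      rw [norm_add_sq_real, ← hj, hr, he]
      field_simp
      ring
    rw [kernel_eq_rpow, e1, Real.mul_rpow (by positivity) (by nlinarith), ← kernel_eq_rpow]
  have k1 := key h i rfl hi.symm hir
  have k2 := key (-h) (-i) (norm_neg h) (by rw [inner_neg_right, neg_div]) (by rwa [abs_neg])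
  rw [← sub_eq_add_neg] at k2
  set x := 2 * i + r ^ 2 with hx
  set y := 2 * -i + r ^ 2 with hy
  obtain ⟨a1, a2⟩ := hexp x ⟨by nlinarith, by nlinarith⟩
  obtain ⟨b1, b2⟩ := hexp y ⟨by nlinarith, by nlinarith⟩
  have xb : |x| ≤ 5 / 2 * r := by rw [abs_le]; constructor <;> nlinarith
  have yb : |y| ≤ 5 / 2 * r := by rw [abs_le]; constructor <;> nlinarith
  have xs : x ^ 2 ≤ 25 / 4 * r ^ 2 := by
    have := pow_le_pow_left₀ (abs_nonneg _) xb 2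
    rw [sq_abs] at this; linarith
  have ys : y ^ 2 ≤ 25 / 4 * r ^ 2 := by
    have := pow_le_pow_left₀ (abs_nonneg _) yb 2
    rw [sq_abs] at this; linarith
  have hsum : x + y = 2 * r ^ 2 := by rw [hx, hy]; ring
  rw [k1, k2]
  set X := (1 + x) ^ (-(1 + s))
  set Y := (1 + y) ^ (-(1 + s))
  constructor
  · rw [← mul_sub, abs_mul, abs_of_nonneg hK, mul_comm _ (kernel s d), mul_assoc]
    refine mul_le_mul_of_nonneg_left ?_ hK
    have h1 : |X - Y| ≤ |X - 1| + |Y - 1| := by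
      have := abs_sub (X - 1) (Y - 1)
      rwa [sub_sub_sub_cancel_right] at this
    have h2 := mul_le_mul_of_nonneg_left xb hC
    have h3 := mul_le_mul_of_nonneg_left yb hC
    have h4 : 0 ≤ (2 * (1 + s) + 13 * C) * r := by positivity
    linarith
  · have e : kernel s d * X + kernel s d * Y - 2 * kernel s d = kernel s d * (X + Y - 2) := by ring
    rw [e, abs_mul, abs_of_nonneg hK, mul_comm _ (kernel s d), mul_assoc]
    refine mul_le_mul_of_nonneg_left ?_ hK
    have e2 : X + Y - 2 = (X - 1 + (1 + s) * x) + (Y - 1 + (1 + s) * y)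
        - (1 + s) * (2 * r ^ 2) := by rw [← hsum]; ring
    have h0 : 0 ≤ C * r ^ 2 := by positivity
    have h1 := abs_le.1 a2
    have h2 := abs_le.1 b2
    have h3 := mul_le_mul_of_nonneg_left xs hC
    have h4 := mul_le_mul_of_nonneg_left ys hC
    have h5 : 0 ≤ (1 + s) * r ^ 2 := by positivity
    rw [e2, abs_le]
    constructor <;> linarith

/-- The logarithmic cutoff. -/
def logCutoff (N : ℕ) (x : Plane) : ℝ := clamp (2 - Real.log (1 + ‖x‖) / N)

lemma abs_logCutoff_sub_le {N : ℕ} (hN : 1 ≤ N) {c : ℝ} (hc : 0 < c) {x y : Plane}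
    (hx : c ≤ 1 + ‖x‖) (hy : c ≤ 1 + ‖y‖) :
    |logCutoff N x - logCutoff N y| ≤ ‖x - y‖ / (N * c) := by
  have hN0 : (0 : ℝ) < N := by exact_mod_cast hN
  have key : ∀ x y : Plane, c ≤ 1 + ‖y‖ →
      Real.log (1 + ‖x‖) - Real.log (1 + ‖y‖) ≤ ‖x - y‖ / c := by
    intro x y hy
    have hx1 : 0 < 1 + ‖x‖ := by positivity
    have hy1 : 0 < 1 + ‖y‖ := by positivity
    rw [← Real.log_div hx1.ne' hy1.ne']
    refine (Real.log_le_sub_one_of_pos (by positivity)).trans ?_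
    rw [div_sub_one hy1.ne']
    refine div_le_div₀ (norm_nonneg _) ?_ hc hy
    linarith [norm_sub_norm_le x y]
  refine (abs_clamp_sub_le _ _).trans ?_
  rw [sub_sub_sub_cancel_left, ← sub_div, abs_div, abs_of_pos hN0, mul_comm, ← div_div]
  refine div_le_div_of_nonneg_right ?_ hN0.le
  rw [abs_sub_le_iff]
  refine ⟨?_, key x y hy⟩
  rw [norm_sub_rev]
  exact key y x hx

lemma isCutoff_logCutoff {N : ℕ} (hN : 1 ≤ N) : IsCutoff (logCutoff N) (Real.exp (2 * N)) where
  supp x hx := by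
    have hN0 : (0 : ℝ) < N := by exact_mod_cast hN
    refine clamp_of_nonpos ?_
    rw [sub_nonpos, le_div_iff₀ hN0, Real.le_log_iff_exp_le (by positivity)]
    linarith
  nonneg x := clamp_nonneg _
  le_one x := clamp_le_one _
  lip x y := by
    refine le_min (abs_clamp_sub_le_one _ _) ?_
    refine (abs_logCutoff_sub_le hN one_pos (by simp) (by simp)).trans ?_
    have : (1 : ℝ) ≤ N := by exact_mod_cast hN
    exact div_le_self (norm_nonneg _) (by linarith)

/-- The mixed second difference of the kernel weighted by the squared increments of a cutoff. -/
def mixedDiff (s : ℝ) (τ : Plane → ℝ) (h : Plane) (p : Plane × Plane) : ℝ :=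
  formIntegrand s τ τ (p.1 - h, p.2 - h) - formIntegrand s τ τ (p.1 - h, p.2)
    - formIntegrand s τ τ (p.1, p.2 - h) + formIntegrand s τ τ p

lemma abs_mixedDiff_le_of_increments {C K₀ K₁ K₂ a a' b b' A δ ρ : ℝ} (hδ : 0 < δ) (hρ : 0 ≤ ρ)
    (hA : 0 ≤ A) (hK : 0 ≤ K₀) (h1 : |K₂ - K₁| ≤ C * K₀ * (ρ / δ))
    (h2 : |K₂ + K₁ - 2 * K₀| ≤ C * K₀ * (ρ / δ) ^ 2)
    (haa : |a' - a| ≤ A * ρ) (hbb : |b' - b| ≤ A * ρ) (hab : |a - b| ≤ A * δ)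
    (hab' : |a' - b'| ≤ A * δ) (h12 : |a' - b| ≤ 2 * A * δ) (h21 : |a - b'| ≤ 2 * A * δ) :
    |(a' - b') * (a' - b') * K₀ - (a' - b) * (a' - b) * K₁ - (a - b') * (a - b') * K₂
      + (a - b) * (a - b) * K₀| ≤ (2 + 6 * C) * (K₀ * A ^ 2 * ρ ^ 2) := by
  have e : (a' - b') * (a' - b') * K₀ - (a' - b) * (a' - b) * K₁ - (a - b') * (a - b') * K₂
      + (a - b) * (a - b) * K₀ = -2 * ((a' - a) * (b' - b)) * K₀
      - 2⁻¹ * ((a' - b) ^ 2 + (a - b') ^ 2) * (K₂ + K₁ - 2 * K₀)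
      + 2⁻¹ * ((((a' - a) + (b' - b)) * ((a - b) + (a' - b'))) * (K₂ - K₁)) := by ring
  have t1 : |-2 * ((a' - a) * (b' - b)) * K₀| ≤ 2 * (K₀ * A ^ 2 * ρ ^ 2) := by
    rw [abs_mul, abs_mul, abs_mul, abs_of_nonneg hK]
    have := mul_le_mul haa hbb (abs_nonneg _) (by positivity)
    have := mul_le_mul_of_nonneg_right this hK
    norm_num
    nlinarith
  have t2 : |2⁻¹ * ((a' - b) ^ 2 + (a - b') ^ 2) * (K₂ + K₁ - 2 * K₀)|
      ≤ 4 * C * (K₀ * A ^ 2 * ρ ^ 2) := by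
    rw [abs_mul]
    have i1 := pow_le_pow_left₀ (abs_nonneg _) h12 2
    have i2 := pow_le_pow_left₀ (abs_nonneg _) h21 2
    rw [sq_abs] at i1 i2
    have i3 : |2⁻¹ * ((a' - b) ^ 2 + (a - b') ^ 2)| ≤ 4 * A ^ 2 * δ ^ 2 := by
      rw [abs_of_nonneg (by positivity)]; nlinarith
    refine (mul_le_mul i3 h2 (abs_nonneg _) (by positivity)).trans (le_of_eq ?_)
    field_simp
  have t3 : |2⁻¹ * ((((a' - a) + (b' - b)) * ((a - b) + (a' - b'))) * (K₂ - K₁))|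
      ≤ 2 * C * (K₀ * A ^ 2 * ρ ^ 2) := by
    rw [abs_mul, abs_mul, abs_mul]
    have i1 : |(a' - a) + (b' - b)| ≤ 2 * A * ρ := (abs_add_le _ _).trans (by linarith)
    have i2 : |(a - b) + (a' - b')| ≤ 2 * A * δ := (abs_add_le _ _).trans (by linarith)
    have i3 := mul_le_mul i1 i2 (abs_nonneg _) (by positivity)
    have i4 := mul_le_mul i3 h1 (abs_nonneg _) (by positivity)
    rw [abs_of_pos (by norm_num : (0 : ℝ) < 2⁻¹)]
    refine (mul_le_mul_of_nonneg_left i4 (by norm_num)).trans (le_of_eq ?_)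
    field_simp
  rw [e]
  refine (abs_add_le _ _).trans ?_
  have := abs_sub (-2 * ((a' - a) * (b' - b)) * K₀)
    (2⁻¹ * ((a' - b) ^ 2 + (a - b') ^ 2) * (K₂ + K₁ - 2 * K₀))
  linarith

lemma mixedDiff_far {s : ℝ} (hs : s ∈ Ioo (0 : ℝ) 1) : ∃ C, 0 ≤ C ∧
    ∀ N : ℕ, 1 ≤ N → ∀ h : Plane, ‖h‖ ≤ 1 / 2 → ∀ p : Plane × Plane, p.1 ≠ p.2 →
      2 * ‖h‖ ≤ ‖p.1 - p.2‖ → ∀ m : ℝ, 0 ≤ m → m ≤ ‖p.1‖ → m ≤ ‖p.2‖ →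
      |mixedDiff s (logCutoff N) h p|
        ≤ C * (‖h‖ ^ 2 / N ^ 2) * (kernel s (p.1 - p.2) * ((1 + m) ^ 2)⁻¹) := by
  obtain ⟨C, hC, hK⟩ := kernel_difference_bounds hs
  refine ⟨(2 + 6 * C) * 4, by positivity, fun N hN h hh p hp hd m hm hx hy => ?_⟩
  obtain ⟨x, y⟩ := p
  simp only at hp hd hx hy ⊢
  have hN0 : (0 : ℝ) < N := by exact_mod_cast hN
  have hd0 : 0 < ‖x - y‖ := norm_pos_iff.2 (sub_ne_zero.2 hp)
  obtain ⟨k1, k2⟩ := hK (x - y) h (sub_ne_zero.2 hp) hd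
  have hc : 0 < (1 + m) / 2 := by positivity
  have cx : (1 + m) / 2 ≤ 1 + ‖x‖ := by linarith
  have cy : (1 + m) / 2 ≤ 1 + ‖y‖ := by linarith
  have cxh : (1 + m) / 2 ≤ 1 + ‖x - h‖ := by linarith [norm_sub_norm_le x h]
  have cyh : (1 + m) / 2 ≤ 1 + ‖y - h‖ := by linarith [norm_sub_norm_le y h]
  have bd : ∀ {x y : Plane} {r : ℝ}, (1 + m) / 2 ≤ 1 + ‖x‖ → (1 + m) / 2 ≤ 1 + ‖y‖ →
      ‖x - y‖ ≤ r → |logCutoff N x - logCutoff N y| ≤ 2 / (N * (1 + m)) * r := by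
    intro x y r h1 h2 h3
    refine (abs_logCutoff_sub_le hN hc h1 h2).trans ?_
    have : ‖x - y‖ / (N * ((1 + m) / 2)) = 2 / (N * (1 + m)) * ‖x - y‖ := by field_simp
    rw [this]
    gcongr
  have n1 : ‖x - h - y‖ ≤ 2 * ‖x - y‖ := by
    have : x - h - y = (x - y) - h := by abel
    rw [this]
    linarith [norm_sub_le (x - y) h]
  have n2 : ‖x - (y - h)‖ ≤ 2 * ‖x - y‖ := by
    have : x - (y - h) = (x - y) + h := by abel
    rw [this]
    linarith [norm_add_le (x - y) h]
  have e1 : x - h - y = x - y - h := by abel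
  have e2 : x - (y - h) = x - y + h := by abel
  have main := abs_mixedDiff_le_of_increments (A := 2 / (N * (1 + m))) hd0 (norm_nonneg h)
    (by positivity) (kernel_nonneg s (x - y)) k1 k2
    (bd cxh cx (by simp)) (bd cyh cy (by simp)) (bd cx cy le_rfl) (bd cxh cyh (by simp))
    ((bd cxh cy n1).trans (le_of_eq (by ring))) ((bd cx cyh n2).trans (le_of_eq (by ring)))
  simp only [mixedDiff, formIntegrand, sub_sub_sub_cancel_right, e1, e2]
  refine main.trans (le_of_eq ?_)
  field_simp
  ring

lemma mixedDiff_near {s R : ℝ} {τ : Plane → ℝ} (hτ : IsCutoff τ R) (h : Plane)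
    (p : Plane × Plane) : |mixedDiff s τ h p| ≤ 2 * tamed s (p.1 - p.2)
      + tamed s (p.1 - p.2 - h) + tamed s (p.1 - p.2 + h) := by
  have b1 := hτ.formIntegrand_le_tamed s (p.1 - h, p.2 - h)
  have b2 := hτ.formIntegrand_le_tamed s (p.1 - h, p.2)
  have b3 := hτ.formIntegrand_le_tamed s (p.1, p.2 - h)
  have b4 := hτ.formIntegrand_le_tamed s p
  have e1 : p.1 - h - p.2 = p.1 - p.2 - h := by abel
  have e2 : p.1 - (p.2 - h) = p.1 - p.2 + h := by abel
  simp only [sub_sub_sub_cancel_right, e1, e2] at b1 b2 b3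
  have n1 := formIntegrand_self_nonneg s τ (p.1 - h, p.2 - h)
  have n2 := formIntegrand_self_nonneg s τ (p.1 - h, p.2)
  have n3 := formIntegrand_self_nonneg s τ (p.1, p.2 - h)
  have n4 := formIntegrand_self_nonneg s τ p
  rw [mixedDiff, abs_le]
  constructor <;> linarith

lemma mixedDiff_eq_zero {s R : ℝ} {τ : Plane → ℝ} (hτ : IsCutoff τ R) {h : Plane}
    (hh : ‖h‖ ≤ 1 / 2) {p : Plane × Plane} (h1 : R + 1 < ‖p.1‖) (h2 : R + 1 < ‖p.2‖) :
    mixedDiff s τ h p = 0 := by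
  have z1 := hτ.supp p.1 (by linarith)
  have z2 := hτ.supp p.2 (by linarith)
  have z3 := hτ.supp (p.1 - h) (by linarith [norm_sub_norm_le p.1 h])
  have z4 := hτ.supp (p.2 - h) (by linarith [norm_sub_norm_le p.2 h])
  simp [mixedDiff, formIntegrand, z1, z2, z3, z4]

/-- The energy density weighted by `(1+|x|)⁻²` on a ball. -/
def weightedEnergy (s ρ : ℝ) (v : Plane → ℝ) (p : Plane × Plane) : ℝ :=
  (closedBall (0 : Plane) ρ).indicator 1 p.1 * ((1 + ‖p.1‖) ^ 2)⁻¹ * formIntegrand s v v p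

lemma weightedEnergy_nonneg (s ρ : ℝ) (v : Plane → ℝ) (p : Plane × Plane) :
    0 ≤ weightedEnergy s ρ v p :=
  mul_nonneg (mul_nonneg (indicator_one_nonneg _ _) (by positivity))
    (formIntegrand_self_nonneg _ _ _)

lemma measurable_weightedEnergy (s ρ : ℝ) {v : Plane → ℝ} (hv : LocLip v) :
    Measurable (weightedEnergy s ρ v) := by
  have h1 : Measurable ((closedBall (0 : Plane) ρ).indicator (1 : Plane → ℝ)) :=
    measurable_one.indicator measurableSet_closedBall
  have h2 := measurable_formIntegrand s hv hv
  unfold weightedEnergy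
  fun_prop

lemma weight_le_sum {N : ℕ} (hN : 1 ≤ N) (x : Plane) :
    (closedBall (0 : Plane) (Real.exp (2 * N) + 1)).indicator 1 x * ((1 + ‖x‖) ^ 2)⁻¹
      ≤ ∑ j ∈ Finset.range (2 * N + 3), Real.exp 1 ^ 2 * ((Real.exp j) ^ 2)⁻¹ *
        (closedBall (0 : Plane) (Real.exp j)).indicator 1 x := by
  have hnn : ∀ j ∈ Finset.range (2 * N + 3), 0 ≤ Real.exp 1 ^ 2 * ((Real.exp j) ^ 2)⁻¹ *
        (closedBall (0 : Plane) (Real.exp j)).indicator (1 : Plane → ℝ) x :=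
    fun j _ => mul_nonneg (by positivity) (indicator_one_nonneg _ _)
  by_cases hx : ‖x‖ ≤ Real.exp (2 * N) + 1
  swap
  · rw [indicator_of_notMem (by simpa using hx), zero_mul]
    exact Finset.sum_nonneg hnn
  rw [indicator_of_mem (by simpa using hx), Pi.one_apply, one_mul]
  have hpos : 0 < 1 + ‖x‖ := by positivity
  have hlog0 : 0 ≤ Real.log (1 + ‖x‖) := Real.log_nonneg (by simp)
  set j := ⌈Real.log (1 + ‖x‖)⌉₊ with hj
  have hj1 : Real.log (1 + ‖x‖) ≤ j := Nat.le_ceil _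
  have hj2 : (j : ℝ) < Real.log (1 + ‖x‖) + 1 := Nat.ceil_lt_add_one hlog0
  have hup : Real.log (1 + ‖x‖) ≤ 2 * N + 1 := by
    rw [Real.log_le_iff_le_exp hpos, Real.exp_add]
    have h1 : (1 : ℝ) ≤ N := by exact_mod_cast hN
    have h2 : (2 : ℝ) ≤ Real.exp 1 := by linarith [Real.add_one_le_exp 1]
    have h3 : (3 : ℝ) ≤ Real.exp (2 * N) := by linarith [Real.add_one_le_exp (2 * (N : ℝ))]
    nlinarith
  have hjmem : j ∈ Finset.range (2 * N + 3) := by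
    rw [Finset.mem_range]
    have : (j : ℝ) < ((2 * N + 3 : ℕ) : ℝ) := by push_cast; linarith
    exact_mod_cast this
  refine le_trans ?_ (Finset.single_le_sum hnn hjmem)
  have hxe : 1 + ‖x‖ ≤ Real.exp j := (Real.log_le_iff_le_exp hpos).1 hj1
  rw [indicator_of_mem (by simp; linarith), Pi.one_apply, mul_one]
  have hlow : Real.exp j ≤ Real.exp 1 * (1 + ‖x‖) := by
    rw [← Real.exp_log hpos, ← Real.exp_add]
    exact Real.exp_le_exp.2 (by linarith)
  have := pow_le_pow_left₀ (Real.exp_pos _).le hlow 2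
  rw [← div_eq_mul_inv, inv_eq_one_div, div_le_div_iff₀ (by positivity) (by positivity), one_mul,
    ← mul_pow]
  exact this

lemma weightedEnergy_growth {s : ℝ} (hs : s ∈ Ioo (0 : ℝ) 1) {v g : Plane → ℝ}
    (hb : ∃ M : ℝ, ∀ y, |v y| ≤ M) (hv : ContDiff ℝ 2 v) (h : Solves s v g) (hg : LocLip g) :
    ∃ C, 0 ≤ C ∧ ∀ N : ℕ, 1 ≤ N →
      Integrable (weightedEnergy s (Real.exp (2 * N) + 1) v) ∧
      ∫ p, weightedEnergy s (Real.exp (2 * N) + 1) v p ≤ C * N := by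
  have hvL : LocLip v := LocLip.of_contDiff hb (hv.of_le (by norm_num))
  obtain ⟨C, hC, hE⟩ := energy_growth hs hb hv h hg
  refine ⟨Real.exp 1 ^ 2 * C * 5, by positivity, fun N hN => ?_⟩
  set S : Plane × Plane → ℝ := fun p => ∑ j ∈ Finset.range (2 * N + 3),
    Real.exp 1 ^ 2 * ((Real.exp j) ^ 2)⁻¹ *
        ((closedBall (0 : Plane) (Real.exp j)).indicator 1 p.1 * formIntegrand s v v p) with hS
  have iS : ∀ j ∈ Finset.range (2 * N + 3), Integrable fun p : Plane × Plane =>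
      Real.exp 1 ^ 2 * ((Real.exp j) ^ 2)⁻¹ *
        ((closedBall (0 : Plane) (Real.exp j)).indicator 1 p.1 * formIntegrand s v v p) :=
    fun j _ => (integrable_indicator_mul_form hs hvL _).const_mul _
  have hle : ∀ p, weightedEnergy s (Real.exp (2 * N) + 1) v p ≤ S p := by
    intro p
    have := mul_le_mul_of_nonneg_right (weight_le_sum hN p.1) (formIntegrand_self_nonneg s v p)
    rw [Finset.sum_mul] at this
    refine this.trans (le_of_eq (Finset.sum_congr rfl fun j _ => ?_))
    ring
  have iS' : Integrable S := integrable_finsetSum _ iS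
  have iW : Integrable (weightedEnergy s (Real.exp (2 * N) + 1) v) :=
    iS'.mono' (measurable_weightedEnergy _ _ hvL).aestronglyMeasurable
      (ae_of_all _ fun p => by
        rw [Real.norm_of_nonneg (weightedEnergy_nonneg _ _ _ _)]; exact hle p)
  refine ⟨iW, (integral_mono iW iS' hle).trans ?_⟩
  rw [hS, integral_finsetSum _ iS]
  calc _ ≤ ∑ j ∈ Finset.range (2 * N + 3), Real.exp 1 ^ 2 * C := by
        refine Finset.sum_le_sum fun j _ => ?_
        rw [integral_const_mul]
        have h1 := hE (Real.exp j) (Real.one_le_exp (by positivity))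
        have h2 := mul_le_mul_of_nonneg_left h1
          (by positivity : 0 ≤ Real.exp 1 ^ 2 * ((Real.exp j) ^ 2)⁻¹)
        refine h2.trans (le_of_eq ?_)
        have := (Real.exp_pos j).ne'
        field_simp
    _ ≤ _ := by
        rw [Finset.sum_const, Finset.card_range, nsmul_eq_mul]
        have h1 : (1 : ℝ) ≤ N := by exact_mod_cast hN
        have h2 : 0 ≤ Real.exp 1 ^ 2 * C := by positivity
        push_cast
        nlinarith

/-- The mass of the tamed kernel on a small ball. -/
def smallMass (s r : ℝ) : ℝ := ∫ z in ball (0 : Plane) r, tamed s z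

lemma tendsto_smallMass {s : ℝ} (hs : s ∈ Ioo (0 : ℝ) 1) {r : ℕ → ℝ}
    (hr : Tendsto r atTop (𝓝 0)) : Tendsto (fun n => smallMass s (r n)) atTop (𝓝 0) := by
  have e : ∀ n, smallMass s (r n) = ∫ z, (ball (0 : Plane) (r n)).indicator (tamed s) z :=
    fun n => (integral_indicator measurableSet_ball).symm
  simp_rw [e]
  rw [show 𝓝 (0 : ℝ) = 𝓝 (∫ _ : Plane, (0 : ℝ)) by rw [integral_zero]]
  refine tendsto_integral_of_dominated_convergence (tamed s) (fun n =>
    ((measurable_tamed s).indicator measurableSet_ball).aestronglyMeasurable)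
    (integrable_tamed hs) (fun n => ae_of_all _ fun z => ?_) (ae_of_all _ fun z => ?_)
  · rw [Real.norm_of_nonneg (indicator_nonneg (fun _ _ => tamed_nonneg s _) z)]
    exact indicator_le_self' (fun _ _ => tamed_nonneg s _) z
  · by_cases hz : z = 0
    · refine tendsto_const_nhds.congr fun n => ?_
      have : tamed s z = 0 := by simp [tamed, hz]
      simp [indicator, this]
    · refine tendsto_const_nhds.congr' ?_
      filter_upwards [hr.eventually_lt_const (norm_pos_iff.2 hz)] with n hn
      rw [indicator_of_notMem]
      simpa using hn.le

/-- The part of the mixed difference close to the diagonal. -/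
def nearPart (s : ℝ) (h z : Plane) : ℝ :=
  2 * (ball (0 : Plane) (3 * ‖h‖)).indicator (tamed s) z
    + (ball (0 : Plane) (3 * ‖h‖)).indicator (tamed s) (z - h)
    + (ball (0 : Plane) (3 * ‖h‖)).indicator (tamed s) (z + h)

lemma nearPart_integral {s : ℝ} (hs : s ∈ Ioo (0 : ℝ) 1) (h : Plane) :
    Integrable (nearPart s h) ∧ ∫ z, nearPart s h z = 4 * smallMass s (3 * ‖h‖) := by
  have i0 : Integrable ((ball (0 : Plane) (3 * ‖h‖)).indicator (tamed s)) :=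
    (integrable_tamed hs).indicator measurableSet_ball
  have i1 := i0.comp_sub_right h
  have i2 := i0.comp_add_right h
  have i3 := i0.const_mul 2
  have i31 : Integrable fun z => 2 * (ball (0 : Plane) (3 * ‖h‖)).indicator (tamed s) z
      + (ball (0 : Plane) (3 * ‖h‖)).indicator (tamed s) (z - h) := i3.add i1
  refine ⟨i31.add i2, ?_⟩
  unfold nearPart
  rw [integral_add i31 i2, integral_add i3 i1, integral_const_mul,
    integral_sub_right_eq_self, integral_add_right_eq_self, integral_indicator measurableSet_ball]
  unfold smallMass
  ring

lemma nearPart_nonneg (s : ℝ) (h z : Plane) : 0 ≤ nearPart s h z := by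
  have : ∀ z, 0 ≤ (ball (0 : Plane) (3 * ‖h‖)).indicator (tamed s) z :=
    fun z => indicator_nonneg (fun _ _ => tamed_nonneg s _) z
  unfold nearPart
  linarith [this z, this (z - h), this (z + h)]

lemma le_nearPart (s : ℝ) {h z : Plane} (hz : ‖z‖ < 2 * ‖h‖) :
    2 * tamed s z + tamed s (z - h) + tamed s (z + h) ≤ nearPart s h z := by
  have h0 : 0 ≤ ‖h‖ := norm_nonneg h
  rw [nearPart, indicator_of_mem (by simp; linarith), indicator_of_mem, indicator_of_mem]
  · simp; linarith [norm_add_le z h]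
  · simp; linarith [norm_sub_le z h]

/-- The mixed second difference tested against the squared increments of a solution. -/
lemma mixedDiff_integral_bound {s : ℝ} (hs : s ∈ Ioo (0 : ℝ) 1) {v g : Plane → ℝ}
    (hb : ∃ M : ℝ, ∀ y, |v y| ≤ M) (hv : ContDiff ℝ 2 v) (hsol : Solves s v g) (hg : LocLip g) :
    ∃ C, 0 ≤ C ∧ ∀ N : ℕ, 1 ≤ N → ∃ D, 0 ≤ D ∧ ∀ h : Plane, ‖h‖ ≤ 1 / 2 →
      |∫ p : Plane × Plane, (v p.1 - v p.2) ^ 2 * mixedDiff s (logCutoff N) h p|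
        ≤ ‖h‖ ^ 2 * (C / N + D * smallMass s (3 * ‖h‖)) := by
  have hvL : LocLip v := LocLip.of_contDiff hb (hv.of_le (by norm_num))
  obtain ⟨C, hC, hfar⟩ := mixedDiff_far hs
  obtain ⟨E, hE, hgrow⟩ := weightedEnergy_growth hs hb hv hsol hg
  refine ⟨C * (2 * E), by positivity, fun N hN => ?_⟩
  have hN0 : (0 : ℝ) < N := by exact_mod_cast hN
  set ρ := Real.exp (2 * N) + 1 with hρ
  obtain ⟨iW, hW⟩ := hgrow N hN
  obtain ⟨L, hL, hlip⟩ := hvL (ρ + 1)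
  have hcut := isCutoff_logCutoff hN
  set V := volume.real (closedBall (0 : Plane) (ρ + 1)) with hV
  refine ⟨4 * L ^ 2 * V * 4, by positivity, fun h hh => ?_⟩
  obtain ⟨iN, hNint⟩ := nearPart_integral hs h
  obtain ⟨iP, hP⟩ := integrable_prod_sub (integrable_indicator_ball (ρ + 1)) iN
  have iW' : Integrable (fun p : Plane × Plane => weightedEnergy s ρ v p.swap) :=
    measurePreserving_swap_plane.integrable_comp_of_integrable iW
  have hpt : ∀ p : Plane × Plane, ‖(v p.1 - v p.2) ^ 2 * mixedDiff s (logCutoff N) h p‖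
      ≤ C * (‖h‖ ^ 2 / N ^ 2) * (weightedEnergy s ρ v p + weightedEnergy s ρ v p.swap)
        + 4 * L ^ 2 * ‖h‖ ^ 2 * ((closedBall (0 : Plane) (ρ + 1)).indicator 1 p.1 *
          nearPart s h (p.1 - p.2)) := by
    intro p
    have t1 : 0 ≤ C * (‖h‖ ^ 2 / N ^ 2) *
        (weightedEnergy s ρ v p + weightedEnergy s ρ v p.swap) :=
      mul_nonneg (by positivity) (add_nonneg (weightedEnergy_nonneg _ _ _ _)
        (weightedEnergy_nonneg _ _ _ _))
    have t2 : 0 ≤ 4 * L ^ 2 * ‖h‖ ^ 2 * ((closedBall (0 : Plane) (ρ + 1)).indicator 1 p.1 *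
          nearPart s h (p.1 - p.2)) :=
      mul_nonneg (by positivity) (mul_nonneg (indicator_one_nonneg _ _) (nearPart_nonneg _ _ _))
    rw [Real.norm_eq_abs, abs_mul, abs_of_nonneg (sq_nonneg _)]
    by_cases hp : p.1 = p.2
    · have : (v p.1 - v p.2) ^ 2 = 0 := by rw [hp]; simp
      rw [this, zero_mul]
      exact add_nonneg t1 t2
    by_cases hout : ρ < ‖p.1‖ ∧ ρ < ‖p.2‖
    · rw [mixedDiff_eq_zero hcut hh hout.1 hout.2, abs_zero, mul_zero]
      linarith
    rcases le_or_gt (2 * ‖h‖) ‖p.1 - p.2‖ with hd | hd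
    · refine le_add_of_le_of_nonneg ?_ t2
      have key : ∀ m, 0 ≤ m → m ≤ ‖p.1‖ → m ≤ ‖p.2‖ →
          (v p.1 - v p.2) ^ 2 * |mixedDiff s (logCutoff N) h p|
            ≤ C * (‖h‖ ^ 2 / N ^ 2) * (((1 + m) ^ 2)⁻¹ * formIntegrand s v v p) := by
        intro m hm h1 h2
        refine (mul_le_mul_of_nonneg_left (hfar N hN h hh p hp hd m hm h1 h2)
          (sq_nonneg _)).trans (le_of_eq ?_)
        rw [formIntegrand]; ring
      rcases le_total ‖p.1‖ ‖p.2‖ with hxy | hxy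
      · have hx : ‖p.1‖ ≤ ρ := not_lt.1 fun hx => hout ⟨hx, hx.trans_le hxy⟩
        refine (key _ (norm_nonneg _) le_rfl hxy).trans
          (mul_le_mul_of_nonneg_left ?_ (by positivity))
        refine le_add_of_le_of_nonneg (le_of_eq ?_) (weightedEnergy_nonneg _ _ _ _)
        rw [weightedEnergy, indicator_of_mem (by simpa using hx), Pi.one_apply, one_mul]
      · have hy : ‖p.2‖ ≤ ρ := not_lt.1 fun hy => hout ⟨hy.trans_le hxy, hy⟩
        refine (key _ (norm_nonneg _) hxy le_rfl).trans
          (mul_le_mul_of_nonneg_left ?_ (by positivity))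
        refine le_add_of_nonneg_of_le (weightedEnergy_nonneg _ _ _ _) (le_of_eq ?_)
        rw [weightedEnergy, Prod.fst_swap, indicator_of_mem (by simpa using hy), Pi.one_apply,
          one_mul, formIntegrand, formIntegrand, Prod.fst_swap, Prod.snd_swap,
          kernel_sub_comm s p.2]
        ring
    · refine le_add_of_nonneg_of_le t1 ?_
      have hx : ‖p.1‖ ≤ ρ + 1 := by
        by_contra hx
        push Not at hx
        refine hout ⟨by linarith, ?_⟩
        linarith [norm_sub_norm_le p.1 p.2]
      rw [indicator_of_mem (by simpa using hx), Pi.one_apply, one_mul]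
      refine mul_le_mul ?_ ((mixedDiff_near hcut h p).trans (le_nearPart s hd)) (abs_nonneg _)
        (by positivity)
      have h1 : |v p.1 - v p.2| ≤ L * (2 * ‖h‖) :=
        (hlip p.1 p.2 hx).trans
          (mul_le_mul_of_nonneg_left ((min_le_right _ _).trans hd.le) hL)
      have h2 := pow_le_pow_left₀ (abs_nonneg _) h1 2
      rw [sq_abs] at h2
      refine h2.trans (le_of_eq (by ring))
  have i1 : Integrable fun p => C * (‖h‖ ^ 2 / N ^ 2) *
      (weightedEnergy s ρ v p + weightedEnergy s ρ v p.swap) := (iW.add iW').const_mul _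
  have i2 := iP.const_mul (4 * L ^ 2 * ‖h‖ ^ 2)
  refine (norm_integral_le_of_norm_le (i1.add i2) (ae_of_all _ hpt)).trans ?_
  rw [integral_add' i1 i2, integral_const_mul, integral_const_mul, hP, hNint,
    integral_indicator_ball]
  have e : ∫ p : Plane × Plane, (weightedEnergy s ρ v p + weightedEnergy s ρ v p.swap)
      = 2 * ∫ p, weightedEnergy s ρ v p := by
    rw [integral_add iW iW', integral_swap (F := weightedEnergy s ρ v)]; ring
  rw [e]
  have : C * (‖h‖ ^ 2 / N ^ 2) * (2 * ∫ p, weightedEnergy s ρ v p)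
      ≤ C * (‖h‖ ^ 2 / N ^ 2) * (2 * (E * N)) := by gcongr
  refine (add_le_add_left this _).trans (le_of_eq ?_)
  rw [← hV]
  field_simp

lemma integral_alternating {F₁ F₂ F₃ F₄ : Plane × Plane → ℝ} (h₁ : Integrable F₁)
    (h₂ : Integrable F₂) (h₃ : Integrable F₃) (h₄ : Integrable F₄) :
    ∫ p, (F₁ p - F₂ p - F₃ p + F₄ p)
      = (∫ p, F₁ p) - (∫ p, F₂ p) - (∫ p, F₃ p) + ∫ p, F₄ p := by
  have h₁₂ : Integrable fun p => F₁ p - F₂ p := h₁.sub h₂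
  have h₁₂₃ : Integrable fun p => F₁ p - F₂ p - F₃ p := h₁₂.sub h₃
  rw [integral_add h₁₂₃ h₄, integral_sub h₁₂ h₃, integral_sub h₁ h₂]

/-- Products of increments of `v` against the cutoff energy, rewritten through the mixed second
difference of the latter. -/
lemma integral_increments_mul_cutoff_form {s : ℝ} (hs : s ∈ Ioo (0 : ℝ) 1) {χ v : Plane → ℝ}
    {R : ℝ} (hχ : IsCutoff χ R) (hv : LocLip v) (h : Plane) :
    ∫ p : Plane × Plane, (v (p.1 + h) - v p.1) * (v (p.2 + h) - v p.2) * formIntegrand s χ χ p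
      = -(1 / 2) * ∫ p : Plane × Plane, (v p.1 - v p.2) ^ 2 * mixedDiff s χ h p := by
  obtain ⟨M, hM0, hM⟩ := hv.bounded
  have hvm := hv.continuous.measurable
  set k := formIntegrand s χ χ with hk
  have iG : ∀ a b : Plane, Integrable fun p : Plane × Plane =>
      (v (p.1 + a) - v (p.2 + b)) ^ 2 * k p := fun a b => by
    refine integrable_mul_cutoff_form hs hχ (by fun_prop) (C := (2 * M) ^ 2) fun p => ?_
    rw [abs_pow]
    refine pow_le_pow_left₀ (abs_nonneg _) ?_ 2
    have := abs_sub (v (p.1 + a)) (v (p.2 + b))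
    linarith [hM (p.1 + a), hM (p.2 + b)]
  have shift : ∀ a b : Plane,
      Integrable (fun p : Plane × Plane => (v p.1 - v p.2) ^ 2 * k (p.1 - a, p.2 - b)) ∧
      ∫ p : Plane × Plane, (v p.1 - v p.2) ^ 2 * k (p.1 - a, p.2 - b)
        = ∫ p : Plane × Plane, (v (p.1 + a) - v (p.2 + b)) ^ 2 * k p := fun a b => by
    have e : ∀ p : Plane × Plane, (v p.1 - v p.2) ^ 2 * k (p.1 - a, p.2 - b)
        = (fun p : Plane × Plane => (v (p.1 + a) - v (p.2 + b)) ^ 2 * k p) (p - (a, b)) :=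
      fun p => by simp [Prod.sub_def]
    have : (volume : Measure (Plane × Plane)).IsAddRightInvariant :=
      inferInstanceAs ((volume : Measure Plane).prod volume).IsAddRightInvariant
    simp_rw [e]
    exact ⟨(iG a b).comp_sub_right (a, b), integral_sub_right_eq_self
      (fun p : Plane × Plane => (v (p.1 + a) - v (p.2 + b)) ^ 2 * k p) (a, b)⟩
  obtain ⟨j1, e1⟩ := shift h h
  obtain ⟨j2, e2⟩ := shift h 0
  obtain ⟨j3, e3⟩ := shift 0 h
  obtain ⟨j4, e4⟩ := shift 0 0
  have lhs : ∫ p : Plane × Plane, (v p.1 - v p.2) ^ 2 * mixedDiff s χ h p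
      = ∫ p : Plane × Plane, ((v p.1 - v p.2) ^ 2 * k (p.1 - h, p.2 - h)
        - (v p.1 - v p.2) ^ 2 * k (p.1 - h, p.2 - 0)
        - (v p.1 - v p.2) ^ 2 * k (p.1 - 0, p.2 - h)
        + (v p.1 - v p.2) ^ 2 * k (p.1 - 0, p.2 - 0)) := by
    congr 1
    ext p
    simp only [mixedDiff, sub_zero, ← hk]
    ring
  rw [lhs, integral_alternating j1 j2 j3 j4, e1, e2, e3, e4,
    ← integral_alternating (iG _ _) (iG _ _) (iG _ _) (iG _ _), ← integral_const_mul]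
  congr 1
  ext p
  simp only [add_zero]
  ring

/-- The density of the energy of the quotient `ξ / φ`, weighted by `φ`. -/
def quotientEnergy (s : ℝ) (ξ φ : Plane → ℝ) (p : Plane × Plane) : ℝ :=
  φ p.1 * φ p.2 * (ξ p.1 / φ p.1 - ξ p.2 / φ p.2) ^ 2 * kernel s (p.1 - p.2)

lemma quotientEnergy_nonneg (s : ℝ) {ξ φ : Plane → ℝ} (hφ : ∀ x, 0 < φ x) (p : Plane × Plane) :
    0 ≤ quotientEnergy s ξ φ p :=
  mul_nonneg (mul_nonneg (mul_nonneg (hφ _).le (hφ _).le) (sq_nonneg _)) (kernel_nonneg _ _)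

lemma quotientEnergy_eq (s : ℝ) {ξ φ : Plane → ℝ} (hφ : ∀ x, 0 < φ x) (p : Plane × Plane) :
    quotientEnergy s ξ φ p =
      formIntegrand s ξ ξ p - formIntegrand s φ (fun x => ξ x * ξ x / φ x) p := by
  have h1 := (hφ p.1).ne'
  have h2 := (hφ p.2).ne'
  rw [quotientEnergy, formIntegrand, formIntegrand]
  field_simp
  ring

lemma integral_quotientEnergy {s : ℝ} (hs : s ∈ Ioo (0 : ℝ) 1) {ξ φ : Plane → ℝ}
    (hξ : LocLip ξ) (hφ : LocLip φ) (hpos : ∀ x, 0 < φ x) {R : ℝ}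
    (hsupp : ∀ x, R < ‖x‖ → ξ x = 0) :
    Integrable (quotientEnergy s ξ φ) ∧ ∫ p, quotientEnergy s ξ φ p =
      form s ξ ξ - form s φ (fun x => ξ x * ξ x / φ x) := by
  have hsupp2 : ∀ x, R < ‖x‖ → ξ x * ξ x = 0 := fun x hx => by simp [hsupp x hx]
  have i1 := integrable_formIntegrand hs hξ hξ hsupp
  have i2 := integrable_formIntegrand hs hφ ((hξ.mul hξ).div_of_support hφ hpos hsupp2)
    (R := R) (fun x hx => by simp [hsupp x hx])
  have e : quotientEnergy s ξ φ = fun p => formIntegrand s ξ ξ p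
      - formIntegrand s φ (fun x => ξ x * ξ x / φ x) p := funext (quotientEnergy_eq s hpos)
  rw [e]
  exact ⟨i1.sub i2, integral_sub i1 i2⟩

/-- The difference quotient of `w` in the direction `e` with step `t`. -/
def diffQuot (t : ℝ) (e : Plane) (w : Plane → ℝ) (x : Plane) : ℝ := t⁻¹ * (w (x + t • e) - w x)

lemma LocLip.const (c : ℝ) : LocLip (fun _ => c) :=
  fun _ => ⟨0, le_rfl, by simp⟩

lemma LocLip.diffQuot {w : Plane → ℝ} (hw : LocLip w) (t : ℝ) (e : Plane) :
    LocLip (diffQuot t e w) :=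
  (LocLip.const t⁻¹).mul ((hw.comp_add _).sub hw)

lemma form_const_mul_left (s c : ℝ) (w u : Plane → ℝ) :
    form s (fun x => c * w x) u = c * form s w u := by
  rw [form, form, ← integral_const_mul]
  congr 1
  ext p
  simp only [formIntegrand]
  ring

lemma Solves.weak_diffQuot {s : ℝ} (hs : s ∈ Ioo (0 : ℝ) 1) {v g : Plane → ℝ}
    (hb : ∃ M : ℝ, ∀ y, |v y| ≤ M) (hv : ContDiff ℝ 2 v) (h : Solves s v g) (hg : LocLip g)
    (t : ℝ) (e : Plane) {η : Plane → ℝ} (hη : LocLip η) {R : ℝ}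
    (hsupp : ∀ x, R < ‖x‖ → η x = 0) :
    form s (diffQuot t e v) η = 2 * ∫ x, diffQuot t e g x * η x := by
  have := h.weak_diff hs hb hv hg (t • e) hη hsupp
  unfold diffQuot
  rw [form_const_mul_left, this, mul_left_comm, ← integral_const_mul]
  simp_rw [mul_assoc]

/-- The energy identity for the quotient of a difference quotient of a solution and a positive
function `φ` solving the linear equation with right-hand side `q`. -/
lemma integral_quotientEnergy_diffQuot {s : ℝ} (hs : s ∈ Ioo (0 : ℝ) 1) {v g : Plane → ℝ}
    (hb : ∃ M : ℝ, ∀ y, |v y| ≤ M) (hv : ContDiff ℝ 2 v) (h : Solves s v g) (hg : LocLip g)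
    {χ : Plane → ℝ} {R : ℝ} (hχ : IsCutoff χ R) {φ q : Plane → ℝ} (hφ : LocLip φ)
    (hpos : ∀ x, 0 < φ x) (hq : LocLip q)
    (hform : ∀ η, LocLip η → (∀ x, R < ‖x‖ → η x = 0) → form s φ η = 2 * ∫ x, q x * η x)
    (t : ℝ) (e : Plane) :
    Integrable (quotientEnergy s (fun x => χ x * diffQuot t e v x) φ) ∧
    ∫ p, quotientEnergy s (fun x => χ x * diffQuot t e v x) φ p =
      -(1 / 2) * (t⁻¹ ^ 2 * ∫ p : Plane × Plane, (v p.1 - v p.2) ^ 2 * mixedDiff s χ (t • e) p)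
      + 2 * ∫ x, χ x ^ 2 * diffQuot t e v x *
          (diffQuot t e g x - q x * (diffQuot t e v x / φ x)) := by
  have hvL : LocLip v := LocLip.of_contDiff hb (hv.of_le (by norm_num))
  have hψ := hvL.diffQuot t e
  have hξ : LocLip (fun x => χ x * diffQuot t e v x) := hχ.locLip.mul hψ
  have hs1 : ∀ x, R < ‖x‖ → χ x * diffQuot t e v x = 0 := fun x hx => by simp [hχ.supp x hx]
  obtain ⟨i, hi⟩ := integral_quotientEnergy hs hξ hφ hpos hs1
  refine ⟨i, hi.trans ?_⟩
  have hη1 : LocLip fun x => χ x * (χ x * diffQuot t e v x) := hχ.locLip.mul hξ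
  have hs2 : ∀ x, R < ‖x‖ → χ x * (χ x * diffQuot t e v x) = 0 := fun x hx => by
    simp [hχ.supp x hx]
  have hη2 : LocLip fun x => χ x * diffQuot t e v x * (χ x * diffQuot t e v x) / φ x :=
    (hξ.mul hξ).div_of_support hφ hpos (R := R) fun x hx => by simp [hχ.supp x hx]
  have hs3 : ∀ x, R < ‖x‖ →
      χ x * diffQuot t e v x * (χ x * diffQuot t e v x) / φ x = 0 := fun x hx => by
    simp [hχ.supp x hx]
  have i1 : Integrable fun x => diffQuot t e g x * (χ x * (χ x * diffQuot t e v x)) :=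
    integrable_of_support ((hg.diffQuot t e).mul hη1) (R := R) fun x hx => by simp [hχ.supp x hx]
  have i2 : Integrable fun x =>
      q x * (χ x * diffQuot t e v x * (χ x * diffQuot t e v x) / φ x) :=
    integrable_of_support (hq.mul hη2) (R := R) fun x hx => by simp [hχ.supp x hx]
  have hmix : ∫ p : Plane × Plane, diffQuot t e v p.1 * diffQuot t e v p.2 * formIntegrand s χ χ p
      = t⁻¹ ^ 2 * (-(1 / 2) * ∫ p : Plane × Plane,
        (v p.1 - v p.2) ^ 2 * mixedDiff s χ (t • e) p) := by
    rw [← integral_increments_mul_cutoff_form hs hχ hvL, ← integral_const_mul]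
    congr 1
    ext p
    simp only [diffQuot]
    ring
  have hforce : ∫ x, χ x ^ 2 * diffQuot t e v x *
        (diffQuot t e g x - q x * (diffQuot t e v x / φ x))
      = (∫ x, diffQuot t e g x * (χ x * (χ x * diffQuot t e v x)))
        - ∫ x, q x * (χ x * diffQuot t e v x * (χ x * diffQuot t e v x) / φ x) := by
    rw [← integral_sub i1 i2]
    congr 1
    ext x
    ring
  rw [form_cutoff_mul hs hχ hψ, h.weak_diffQuot hs hb hv hg t e hη1 hs2, hmix, hform _ hη2 hs3,
    hforce]
  ring

lemma measurable_quotientEnergy (s : ℝ) {ξ φ : Plane → ℝ} (hξ : Measurable ξ)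
    (hφ : Measurable φ) : Measurable (quotientEnergy s ξ φ) := by
  unfold quotientEnergy
  fun_prop

/-- Lower semicontinuity of the quotient energy under pointwise convergence. -/
lemma lintegral_quotientEnergy_le {s : ℝ} {ξ φ : ℕ → Plane → ℝ} {ξ' φ' : Plane → ℝ}
    (hξ : ∀ n, Measurable (ξ n)) (hφ : ∀ n, Measurable (φ n)) (hpos : ∀ x, 0 < φ' x)
    (hξt : ∀ x, Tendsto (fun n => ξ n x) atTop (𝓝 (ξ' x)))
    (hφt : ∀ x, Tendsto (fun n => φ n x) atTop (𝓝 (φ' x)))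
    {r : ℕ → ℝ} {r' : ℝ} (hr : Tendsto r atTop (𝓝 r'))
    (hle : ∀ᶠ n in atTop, ∫⁻ p, ENNReal.ofReal (quotientEnergy s (ξ n) (φ n) p)
      ≤ ENNReal.ofReal (r n)) :
    ∫⁻ p, ENNReal.ofReal (quotientEnergy s ξ' φ' p) ≤ ENNReal.ofReal r' := by
  have hlim : ∀ p : Plane × Plane, Tendsto (fun n => quotientEnergy s (ξ n) (φ n) p) atTop
      (𝓝 (quotientEnergy s ξ' φ' p)) := fun p =>
    (((hφt p.1).mul (hφt p.2)).mul ((((hξt p.1).div (hφt p.1) (hpos _).ne').sub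
      ((hξt p.2).div (hφt p.2) (hpos _).ne')).pow 2)).mul_const _
  calc ∫⁻ p, ENNReal.ofReal (quotientEnergy s ξ' φ' p)
      = ∫⁻ p, liminf (fun n => ENNReal.ofReal (quotientEnergy s (ξ n) (φ n) p)) atTop := by
        refine lintegral_congr fun p => ?_
        exact ((ENNReal.continuous_ofReal.tendsto _).comp (hlim p)).liminf_eq.symm
    _ ≤ liminf (fun n => ∫⁻ p, ENNReal.ofReal (quotientEnergy s (ξ n) (φ n) p)) atTop :=
        lintegral_liminf_le fun n => (measurable_quotientEnergy s (hξ n) (hφ n)).ennreal_ofReal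
    _ ≤ liminf (fun n => ENNReal.ofReal (r n)) atTop := liminf_le_liminf hle
    _ = ENNReal.ofReal r' := ((ENNReal.continuous_ofReal.tendsto _).comp hr).liminf_eq

lemma tendsto_diffQuot {w : Plane → ℝ} {x : Plane} (hw : DifferentiableAt ℝ w x) (e : Plane)
    {t : ℕ → ℝ} (ht : ∀ n, 0 < t n) (ht0 : Tendsto t atTop (𝓝 0)) :
    Tendsto (fun n => diffQuot (t n) e w x) atTop (𝓝 (fderiv ℝ w x e)) :=
  (hw.hasFDerivAt.hasLineDerivAt e).tendsto_slope_zero.comp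
    (tendsto_nhdsWithin_iff.2 ⟨ht0, Eventually.of_forall fun n => (ht n).ne'⟩)

lemma tendsto_logCutoff (x : Plane) : Tendsto (fun N => logCutoff N x) atTop (𝓝 1) := by
  refine tendsto_const_nhds.congr' ?_
  obtain ⟨m, hm⟩ := exists_nat_ge (Real.log (1 + ‖x‖))
  filter_upwards [eventually_ge_atTop (max m 1)] with N hN
  have h1 : (1 : ℝ) ≤ N := by exact_mod_cast (le_max_right m 1).trans hN
  have h2 : (m : ℝ) ≤ N := by exact_mod_cast (le_max_left m 1).trans hN
  have h3 : Real.log (1 + ‖x‖) / N ≤ 1 := (div_le_one (by linarith)).2 (hm.trans h2)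
  exact (clamp_of_one_le (by linarith)).symm

/-- If the forcing terms vanish in the limit, the quotient of a directional derivative of the
solution and the limit of the positive functions `φ n` has vanishing energy. -/
lemma lintegral_quotientEnergy_fderiv_eq_zero {s : ℝ} (hs : s ∈ Ioo (0 : ℝ) 1)
    {v g : Plane → ℝ} (hb : ∃ M : ℝ, ∀ y, |v y| ≤ M) (hv : ContDiff ℝ 2 v) (h : Solves s v g)
    (hg : LocLip g) {e : Plane} (he : ‖e‖ = 1) {t : ℕ → ℝ} (ht : ∀ n, 0 < t n)
    (ht2 : ∀ n, t n ≤ 1 / 2) (ht0 : Tendsto t atTop (𝓝 0)) {φ q : ℕ → Plane → ℝ}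
    (hφ : ∀ n, LocLip (φ n)) (hpos : ∀ n x, 0 < φ n x) (hq : ∀ n, LocLip (q n))
    (hform : ∀ n R η, LocLip η → (∀ x, R < ‖x‖ → η x = 0) →
      form s (φ n) η = 2 * ∫ x, q n x * η x)
    {φ' : Plane → ℝ} (hφc : Continuous φ') (hpos' : ∀ x, 0 < φ' x)
    (hφt : ∀ x, Tendsto (fun n => φ n x) atTop (𝓝 (φ' x)))
    (hforce : ∀ χ R, IsCutoff χ R → Tendsto (fun n => ∫ x, χ x ^ 2 * diffQuot (t n) e v x *
      (diffQuot (t n) e g x - q n x * (diffQuot (t n) e v x / φ n x))) atTop (𝓝 0)) :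
    ∫⁻ p, ENNReal.ofReal (quotientEnergy s (fun x => fderiv ℝ v x e) φ' p) = 0 := by
  have hvL : LocLip v := LocLip.of_contDiff hb (hv.of_le (by norm_num))
  have hψc : Continuous fun x => fderiv ℝ v x e :=
    (hv.continuous_fderiv two_ne_zero).clm_apply continuous_const
  obtain ⟨C, hC, hmix⟩ := mixedDiff_integral_bound hs hb hv h hg
  have hcut : ∀ N : ℕ, 1 ≤ N → ∫⁻ p, ENNReal.ofReal
      (quotientEnergy s (fun x => logCutoff N x * fderiv ℝ v x e) φ' p)
        ≤ ENNReal.ofReal (1 / 2 * (C / N)) := by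
    intro N hN
    have hχ := isCutoff_logCutoff hN
    have hχm := hχ.locLip.continuous.measurable
    obtain ⟨D, hD, hmixN⟩ := hmix N hN
    have hnorm : ∀ n, ‖t n • e‖ = t n := fun n => by
      rw [norm_smul, he, mul_one, Real.norm_of_nonneg (ht n).le]
    have hr : Tendsto (fun n => 1 / 2 * (C / N + D * smallMass s (3 * t n))
        + 2 * ∫ x, logCutoff N x ^ 2 * diffQuot (t n) e v x *
          (diffQuot (t n) e g x - q n x * (diffQuot (t n) e v x / φ n x))) atTop
        (𝓝 (1 / 2 * (C / N + D * 0) + 2 * 0)) := by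
      refine (((tendsto_smallMass hs ?_).const_mul D).const_add _ |>.const_mul _).add
        ((hforce _ _ hχ).const_mul 2)
      simpa using ht0.const_mul 3
    rw [mul_zero, add_zero, mul_zero, add_zero] at hr
    refine lintegral_quotientEnergy_le (ξ := fun n x => logCutoff N x * diffQuot (t n) e v x)
      (fun n => hχm.mul (hvL.diffQuot (t n) e).continuous.measurable)
      (fun n => (hφ n).continuous.measurable) hpos'
      (fun x => (tendsto_diffQuot (hv.differentiable two_ne_zero x) e ht ht0).const_mul _) hφt hr
      (Eventually.of_forall fun n => ?_)
    obtain ⟨i, hi⟩ := integral_quotientEnergy_diffQuot hs hb hv h hg hχ (hφ n) (hpos n) (hq n)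
      (hform n _) (t n) e
    rw [← ofReal_integral_eq_lintegral_ofReal i
      (ae_of_all _ fun p => quotientEnergy_nonneg s (hpos n) p), hi]
    refine ENNReal.ofReal_le_ofReal (add_le_add_left ?_ _)
    have h1 := hmixN (t n • e) (by rw [hnorm]; exact ht2 n)
    rw [hnorm] at h1
    set I := ∫ p : Plane × Plane, (v p.1 - v p.2) ^ 2 * mixedDiff s (logCutoff N) (t n • e) p
    have h2 : (t n)⁻¹ ^ 2 * |I| ≤ C / N + D * smallMass s (3 * t n) := by
      have := mul_le_mul_of_nonneg_left h1 (sq_nonneg (t n)⁻¹)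
      rwa [← mul_assoc, ← mul_pow, inv_mul_cancel₀ (ht n).ne', one_pow, one_mul] at this
    have h3 := mul_le_mul_of_nonneg_left (neg_abs_le I) (sq_nonneg (t n)⁻¹)
    linarith
  have := lintegral_quotientEnergy_le (s := s) (ξ := fun N x => logCutoff N x * fderiv ℝ v x e)
    (φ := fun _ => φ') (ξ' := fun x => fderiv ℝ v x e) (r := fun N => 1 / 2 * (C / N)) (r' := 0)
    (fun N => ?_) (fun _ => hφc.measurable) hpos' (fun x => ?_) (fun x => tendsto_const_nhds)
    ?_ (by filter_upwards [eventually_ge_atTop 1] with N hN using hcut N hN)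
  · simpa using this
  · have : Measurable (logCutoff N) := by
      unfold logCutoff clamp; fun_prop
    exact this.mul hψc.measurable
  · simpa using (tendsto_logCutoff x).mul_const (fderiv ℝ v x e)
  · rw [← mul_zero (1 / 2 : ℝ)]
    exact (tendsto_const_div_atTop_nhds_zero_nat C).const_mul _

/-- Quotients of continuous functions with vanishing energy are constant. -/
lemma exists_eq_const_mul_of_lintegral_quotientEnergy_eq_zero {s : ℝ} {ξ φ : Plane → ℝ}
    (hξ : Continuous ξ) (hφ : Continuous φ) (hpos : ∀ x, 0 < φ x)
    (h0 : ∫⁻ p, ENNReal.ofReal (quotientEnergy s ξ φ p) = 0) : ∃ c, ∀ x, ξ x = c * φ x := by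
  rw [lintegral_eq_zero_iff
    (measurable_quotientEnergy s hξ.measurable hφ.measurable).ennreal_ofReal] at h0
  have hσ : Continuous fun x => ξ x / φ x := hξ.div hφ fun x => (hpos x).ne'
  have key : (fun p : Plane × Plane => ξ p.1 / φ p.1) = fun p => ξ p.2 / φ p.2 := by
    refine Measure.eq_of_ae_eq (μ := (volume : Measure Plane).prod volume) ?_
      (hσ.comp continuous_fst) (hσ.comp continuous_snd)
    filter_upwards [h0] with p hp
    by_cases hd : p.1 = p.2
    · rw [hd]
    have h1 : quotientEnergy s ξ φ p = 0 :=
      le_antisymm (ENNReal.ofReal_eq_zero.1 hp) (quotientEnergy_nonneg s hpos p)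
    have hk := kernel_pos s (sub_ne_zero.2 hd)
    simp only [quotientEnergy, mul_eq_zero, (hpos _).ne', hk.ne', or_false, false_or,
      pow_eq_zero_iff two_ne_zero] at h1
    exact sub_eq_zero.1 h1
  refine ⟨ξ 0 / φ 0, fun x => ?_⟩
  have := congrFun key (x, 0)
  simp only at this
  rw [← this, div_mul_cancel₀ _ (hpos x).ne']

lemma LocLip.ae_differentiableAt {g : Plane → ℝ} (hg : LocLip g) :
    ∀ᵐ x, DifferentiableAt ℝ g x := by
  have h : ∀ n : ℕ, ∀ᵐ x : Plane, x ∈ ball (0 : Plane) n → DifferentiableAt ℝ g x := by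
    intro n
    obtain ⟨C, hC, hlip⟩ := hg n
    have hl : LipschitzOnWith ⟨C, hC⟩ g (ball (0 : Plane) n) :=
      LipschitzOnWith.of_dist_le_mul fun x hx y _ => by
        rw [Real.dist_eq, dist_eq_norm]
        exact (hlip x y (by simpa using (mem_ball_zero_iff.1 hx).le)).trans
          (mul_le_mul_of_nonneg_left (min_le_right _ _) hC)
    filter_upwards [hl.ae_differentiableWithinAt_of_mem] with x hx hxn
    exact (hx hxn).differentiableAt (isOpen_ball.mem_nhds hxn)
  filter_upwards [ae_all_iff.2 h] with x hx
  obtain ⟨n, hn⟩ := exists_nat_gt ‖x‖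
  exact hx n (by simpa using hn)

/-- A function which is Lipschitz with respect to `v` has its differential annihilated by the
kernel of the differential of `v`. -/
lemma fderiv_eq_zero_of_abs_sub_le {v g : Plane → ℝ} {L : ℝ}
    (hgv : ∀ x y, |g x - g y| ≤ L * |v x - v y|) {x : Plane} (hv : DifferentiableAt ℝ v x)
    (hg : DifferentiableAt ℝ g x) {w : Plane} (hw : fderiv ℝ v x w = 0) :
    fderiv ℝ g x w = 0 := by
  have ht : ∀ n : ℕ, 0 < 1 / ((n : ℝ) + 1) := fun n => by positivity
  have h1 := (tendsto_diffQuot hg w ht tendsto_one_div_add_atTop_nhds_zero_nat).abs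
  have h2 := (tendsto_diffQuot hv w ht tendsto_one_div_add_atTop_nhds_zero_nat).abs.const_mul L
  rw [hw, abs_zero, mul_zero] at h2
  have := le_of_tendsto_of_tendsto' h1 h2 fun n => by
    rw [diffQuot, diffQuot, abs_mul, abs_mul, mul_left_comm]
    exact mul_le_mul_of_nonneg_left (hgv _ _) (abs_nonneg _)
  exact abs_nonpos_iff.1 this

lemma fderiv_mul_comm_of_abs_sub_le {v g : Plane → ℝ} {L : ℝ}
    (hgv : ∀ x y, |g x - g y| ≤ L * |v x - v y|) {x : Plane} (hv : DifferentiableAt ℝ v x)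
    (hg : DifferentiableAt ℝ g x) (e e' : Plane) :
    fderiv ℝ g x e * fderiv ℝ v x e' = fderiv ℝ g x e' * fderiv ℝ v x e := by
  have := fderiv_eq_zero_of_abs_sub_le hgv hv hg
    (w := fderiv ℝ v x e' • e - fderiv ℝ v x e • e') (by simp; ring)
  simp only [map_sub, map_smul, smul_eq_mul] at this
  linarith

lemma LocLip.abs_diffQuot_le {w : Plane → ℝ} {C R : ℝ} (hC : 0 ≤ C)
    (hw : ∀ x y, ‖x‖ ≤ R → |w x - w y| ≤ C * min 1 ‖x - y‖) {t : ℝ} (ht : 0 < t) {e : Plane}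
    (he : ‖e‖ = 1) {x : Plane} (hx : ‖x‖ ≤ R) : |FractionalSymmetry.diffQuot t e w x| ≤ C := by
  have h1 := (hw x (x + t • e) hx).trans (mul_le_mul_of_nonneg_left (min_le_right _ _) hC)
  rw [sub_add_cancel_left, norm_neg, norm_smul, he, mul_one, Real.norm_of_nonneg ht.le,
    abs_sub_comm] at h1
  rw [FractionalSymmetry.diffQuot, abs_mul, abs_of_pos (inv_pos.2 ht), inv_mul_le_iff₀ ht,
    mul_comm t]
  exact h1

lemma exists_diffQuot_eq {v : Plane → ℝ} (hv : Differentiable ℝ v) {t : ℝ} (ht : 0 < t)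
    (e x : Plane) : ∃ c ∈ Ioo 0 t, diffQuot t e v x = fderiv ℝ v (x + c • e) e := by
  have hd : ∀ r : ℝ, HasDerivAt (fun r : ℝ => v (x + r • e)) (fderiv ℝ v (x + r • e) e) r :=
    fun r => by
      have h1 : HasDerivAt (fun r : ℝ => x + r • e) e r := by
        simpa using ((hasDerivAt_id r).smul_const e).const_add x
      exact (hv _).hasFDerivAt.comp_hasDerivAt r h1
  obtain ⟨c, hc, h⟩ := exists_hasDerivAt_eq_slope (fun r : ℝ => v (x + r • e)) _ ht
    (fun r _ => (hd r).continuousAt.continuousWithinAt) (fun r _ => hd r)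
  refine ⟨c, hc, ?_⟩
  rw [h, diffQuot, zero_smul, add_zero, sub_zero, inv_mul_eq_div]

/-- The forcing terms of the energy identity vanish in the limit. -/
lemma tendsto_forcing {v g : Plane → ℝ} (hv : ContDiff ℝ 2 v) (hvL : LocLip v) (hg : LocLip g)
    {L : ℝ} (hgv : ∀ x y, |g x - g y| ≤ L * |v x - v y|) {e e' : Plane} (he : ‖e‖ = 1)
    (he' : ‖e'‖ = 1) (hmono : ∀ x, 0 < fderiv ℝ v x e') {t : ℕ → ℝ} (ht : ∀ n, 0 < t n)
    (ht2 : ∀ n, t n ≤ 1 / 2) (ht0 : Tendsto t atTop (𝓝 0)) {χ : Plane → ℝ} {R : ℝ}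
    (hχ : IsCutoff χ R) :
    Tendsto (fun n => ∫ x, χ x ^ 2 * diffQuot (t n) e v x * (diffQuot (t n) e g x
      - diffQuot (t n) e' g x * (diffQuot (t n) e v x / diffQuot (t n) e' v x))) atTop (𝓝 0) := by
  have hvd := hv.differentiable two_ne_zero
  have hc : Continuous fun x => fderiv ℝ v x e' :=
    (hv.continuous_fderiv two_ne_zero).clm_apply continuous_const
  obtain ⟨A, hA, hvA⟩ := hvL R
  obtain ⟨B, hB, hgB⟩ := hg R
  obtain ⟨c, hc0, hcle⟩ : ∃ c, 0 < c ∧ ∀ x, ‖x‖ ≤ R → ∀ n, c ≤ diffQuot (t n) e' v x := by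
    by_cases hR : (closedBall (0 : Plane) (R + 1)).Nonempty
    · obtain ⟨x₀, -, h⟩ := (isCompact_closedBall (0 : Plane) (R + 1)).exists_isMinOn hR
        hc.continuousOn
      refine ⟨_, hmono x₀, fun x hx n => ?_⟩
      obtain ⟨r, hr, h'⟩ := exists_diffQuot_eq hvd (ht n) e' x
      rw [h']
      refine h ?_
      rw [mem_closedBall_zero_iff]
      refine (norm_add_le _ _).trans (add_le_add hx ?_)
      rw [norm_smul, he', mul_one, Real.norm_of_nonneg hr.1.le]
      linarith [hr.2, ht2 n]
    · refine ⟨1, one_pos, fun x hx => (hR ⟨x, ?_⟩).elim⟩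
      rw [mem_closedBall_zero_iff]
      linarith
  have hχm := hχ.locLip.continuous.measurable
  have hm : ∀ n e w, LocLip w → Measurable (diffQuot (t n) e w) :=
    fun n e w hw => (hw.diffQuot (t n) e).continuous.measurable
  rw [show 𝓝 (0 : ℝ) = 𝓝 (∫ _ : Plane, (0 : ℝ)) by rw [integral_zero]]
  refine tendsto_integral_of_dominated_convergence
    (fun x => A * (B + B * (A / c)) * (closedBall (0 : Plane) R).indicator 1 x) (fun n => ?_)
    ((integrable_indicator_ball R).const_mul _) (fun n => ae_of_all _ fun x => ?_) ?_
  · have h1 := hm n e v hvL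
    have h2 := hm n e' v hvL
    have h3 := hm n e g hg
    have h4 := hm n e' g hg
    exact Measurable.aestronglyMeasurable (by fun_prop)
  · by_cases hx : ‖x‖ ≤ R
    swap
    · rw [hχ.supp x (not_le.1 hx), indicator_of_notMem (by simpa using hx)]
      simp
    rw [indicator_of_mem (by simpa using hx), Pi.one_apply, mul_one, Real.norm_eq_abs, abs_mul,
      abs_mul, abs_of_nonneg (sq_nonneg _)]
    have hχ1 : χ x ^ 2 ≤ 1 := pow_le_one₀ (hχ.nonneg x) (hχ.le_one x)
    have hv1 := LocLip.abs_diffQuot_le hA hvA (ht n) he hx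
    have hg1 := LocLip.abs_diffQuot_le hB hgB (ht n) he hx
    have hg2 := LocLip.abs_diffQuot_le hB hgB (ht n) he' hx
    refine mul_le_mul ?_ ?_ (abs_nonneg _) hA
    · calc _ ≤ 1 * A := mul_le_mul hχ1 hv1 (abs_nonneg _) zero_le_one
        _ = A := one_mul A
    · refine (abs_sub _ _).trans (add_le_add hg1 ?_)
      rw [abs_mul, abs_div, abs_of_pos (hc0.trans_le (hcle x hx n))]
      have hd := hcle x hx n
      exact mul_le_mul hg2 (div_le_div₀ hA hv1 hc0 hd)
        (div_nonneg (abs_nonneg _) (hc0.le.trans hd)) hB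
  · filter_upwards [hg.ae_differentiableAt] with x hx
    have h1 := fun e => tendsto_diffQuot (hvd x) e ht ht0
    have h2 := fun e => tendsto_diffQuot hx e ht ht0
    have h3 := ((h1 e).const_mul (χ x ^ 2)).mul
      ((h2 e).sub ((h2 e').mul ((h1 e).div (h1 e') (hmono x).ne')))
    rwa [← mul_div_assoc, ← fderiv_mul_comm_of_abs_sub_le hgv (hvd x) hx e e',
      mul_div_cancel_right₀ _ (hmono x).ne', sub_self, mul_zero] at h3

lemma eq_of_fderiv_eq_zero {v : Plane → ℝ} (hv : Differentiable ℝ v) {e : Plane}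
    (h : ∀ x, fderiv ℝ v x e = 0) (x : Plane) (r : ℝ) : v (x + r • e) = v x := by
  have hpos : ∀ t : ℝ, 0 < t → ∀ x, v (x + t • e) = v x := fun t ht x => by
    obtain ⟨c, -, hc⟩ := exists_diffQuot_eq hv ht e x
    rw [h, diffQuot, mul_eq_zero, or_iff_right (inv_ne_zero ht.ne'), sub_eq_zero] at hc
    exact hc
  rcases lt_trichotomy r 0 with hr | rfl | hr
  · have := hpos (-r) (neg_pos.2 hr) (x + r • e)
    rw [neg_smul, add_neg_cancel_right] at this
    exact this.symm
  · simp
  · exact hpos r hr x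

/-- Constancy along a direction means dependence on the orthogonal variable only. -/
lemma exists_profile {v : Plane → ℝ} (hv : Differentiable ℝ v) {c : ℝ}
    (h : ∀ x, fderiv ℝ v x (EuclideanSpace.single 0 1)
      = c * fderiv ℝ v x (EuclideanSpace.single 1 1)) :
    ∃ ω : Plane, ‖ω‖ = 1 ∧ ∃ vo : ℝ → ℝ, ∀ y, v y = vo ⟪ω, y⟫ := by
  set ℓ := √(1 + c ^ 2) with hℓ
  have hℓ2 : ℓ ^ 2 = 1 + c ^ 2 := Real.sq_sqrt (by positivity)
  have hℓ0 : 0 < ℓ := Real.sqrt_pos.2 (by positivity)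
  have hconst := eq_of_fderiv_eq_zero hv
    (e := EuclideanSpace.single 0 1 - c • EuclideanSpace.single 1 1) (fun x => by simp [h x])
  set ω : Plane := !₂[c / ℓ, 1 / ℓ] with hω
  refine ⟨ω, ?_, fun r => v (r • ω), fun y => ?_⟩
  · rw [EuclideanSpace.norm_eq, Real.sqrt_eq_one]
    simp [Fin.sum_univ_two, hω]
    field_simp
    rw [hℓ2]; ring
  · have hin : ⟪ω, y⟫ = (c * y 0 + y 1) / ℓ := by
      simp [PiLp.inner_apply, Fin.sum_univ_two, hω]
      ring
    have := hconst (⟪ω, y⟫ • ω) (y 0 - (c * y 0 + y 1) * c / ℓ ^ 2)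
    refine Eq.trans (congrArg v ?_) this
    rw [hin]
    ext i
    fin_cases i
    · simp [hω]
      field_simp
      ring
    · simp [hω]
      field_simp
      rw [hℓ2]
      ring

lemma exists_steps : ∃ t : ℕ → ℝ, (∀ n, 0 < t n) ∧ (∀ n, t n ≤ 1 / 2) ∧
    Tendsto t atTop (𝓝 0) := by
  refine ⟨fun n => 1 / 2 * (1 / ((n : ℝ) + 1)), fun n => by positivity, fun n => ?_, ?_⟩
  · have : 1 / ((n : ℝ) + 1) ≤ 1 := (div_le_one (by positivity)).2 (by simp)
    linarith
  · rw [← mul_zero (1 / 2 : ℝ)]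
    exact tendsto_one_div_add_atTop_nhds_zero_nat.const_mul _

/-- Proportional partial derivatives for monotone solutions. -/
lemma exists_fderiv_eq_const_mul_of_monotone {s : ℝ} (hs : s ∈ Ioo (0 : ℝ) 1)
    {v g : Plane → ℝ} (hb : ∃ M : ℝ, ∀ y, |v y| ≤ M) (hv : ContDiff ℝ 2 v) (h : Solves s v g)
    (hg : LocLip g) {L : ℝ} (hgv : ∀ x y, |g x - g y| ≤ L * |v x - v y|) {e e' : Plane}
    (he : ‖e‖ = 1) (he' : ‖e'‖ = 1) (hmono : ∀ x, 0 < fderiv ℝ v x e') :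
    ∃ c, ∀ x, fderiv ℝ v x e = c * fderiv ℝ v x e' := by
  have hvL : LocLip v := LocLip.of_contDiff hb (hv.of_le (by norm_num))
  have hvd := hv.differentiable two_ne_zero
  have hc : ∀ e, Continuous fun x => fderiv ℝ v x e := fun e =>
    (hv.continuous_fderiv two_ne_zero).clm_apply continuous_const
  obtain ⟨t, ht, ht2, ht0⟩ := exists_steps
  refine exists_eq_const_mul_of_lintegral_quotientEnergy_eq_zero (hc e) (hc e') hmono
    (lintegral_quotientEnergy_fderiv_eq_zero hs hb hv h hg he ht ht2 ht0
      (φ := fun n => diffQuot (t n) e' v) (q := fun n => diffQuot (t n) e' g)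
      (fun n => hvL.diffQuot _ _) (fun n x => ?_) (fun n => hg.diffQuot _ _)
      (fun n R η hη hsupp => h.weak_diffQuot hs hb hv hg _ _ hη hsupp) (hc e') hmono
      (fun x => tendsto_diffQuot (hvd x) e' ht ht0)
      fun χ R hχ => tendsto_forcing hv hvL hg hgv he he' hmono ht ht2 ht0 hχ)
  obtain ⟨c, -, hc⟩ := exists_diffQuot_eq hvd (ht n) e' x
  rw [hc]
  exact hmono _

/-- Partial derivatives of bounded fractional harmonic functions vanish. -/
lemma fderiv_eq_zero_of_harmonic {s : ℝ} (hs : s ∈ Ioo (0 : ℝ) 1)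
    {v : Plane → ℝ} (hb : ∃ M : ℝ, ∀ y, |v y| ≤ M) (hv : ContDiff ℝ 2 v)
    (h : Solves s v fun _ => 0) {e : Plane} (he : ‖e‖ = 1) (x : Plane) :
    fderiv ℝ v x e = 0 := by
  have hvd := hv.differentiable two_ne_zero
  have h0 := LocLip.const 0
  obtain ⟨t, ht, ht2, ht0⟩ := exists_steps
  obtain ⟨c, hc⟩ := exists_eq_const_mul_of_lintegral_quotientEnergy_eq_zero
    ((hv.continuous_fderiv two_ne_zero).clm_apply continuous_const) continuous_const
    (fun _ => one_pos) (lintegral_quotientEnergy_fderiv_eq_zero hs hb hv h h0 he ht ht2 ht0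
      (φ := fun _ _ => 1) (q := fun _ _ => 0) (fun _ => LocLip.const 1) (fun _ _ => one_pos)
      (fun _ => h0) (fun n R η _ _ => by simp [form, formIntegrand]) continuous_const
      (fun _ => one_pos) (fun x => tendsto_const_nhds) fun χ R hχ => by simp [diffQuot])
  rw [hc, mul_one]
  obtain ⟨M, hM⟩ := hb
  by_contra hne
  have hM0 : 0 ≤ M := (abs_nonneg _).trans (hM 0)
  set r := (2 * M + 1) / |c| with hr
  have hr0 : 0 < r := by positivity
  obtain ⟨d, -, hd⟩ := exists_diffQuot_eq hvd hr0 e x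
  rw [hc, mul_one, diffQuot, inv_mul_eq_iff_eq_mul₀ hr0.ne'] at hd
  have h1 := abs_sub (v (x + r • e)) (v x)
  rw [hd, abs_mul, abs_of_pos hr0, hr, div_mul_cancel₀ _ (abs_pos.2 hne).ne'] at h1
  linarith [hM (x + r • e), hM x]

end FractionalSymmetry

open FractionalSymmetry

/-- Theorem 1.3 (symmetry for the fractional equation (-Δ)^s v = f(v) in ℝ²):
a bounded C² solution, understood in the principal-value sense, which satisfies
either f ≡ 0 or ∂_{y₂} v > 0, depends on only one Euclidean variable. -/
theorem fractional_symmetry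
    (s : ℝ) (hs : s ∈ Ioo (0:ℝ) 1)
    (f : ℝ → ℝ) (hf : LocallyLipschitz f)
    (v : EuclideanSpace ℝ (Fin 2) → ℝ)
    (hvb : ∃ M : ℝ, ∀ y, |v y| ≤ M)
    (hv : ContDiff ℝ 2 v)
    (heq : ∀ y : EuclideanSpace ℝ (Fin 2),
      Tendsto (fun ε : ℝ =>
          ∫ z in {z : EuclideanSpace ℝ (Fin 2) | ε ≤ dist z y},
            (v y - v z) / dist y z ^ (2 + 2 * s))
        (𝓝[>] (0:ℝ)) (𝓝 (f (v y))))
    (hcond : (∀ t : ℝ, f t = 0) ∨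
      (∀ y : EuclideanSpace ℝ (Fin 2), 0 < fderiv ℝ v y (EuclideanSpace.single 1 1))) :
    ∃ ω : EuclideanSpace ℝ (Fin 2), ‖ω‖ = 1 ∧
      ∃ vo : ℝ → ℝ, ∀ y, v y = vo ⟪ω, y⟫ := by
  have hvd := hv.differentiable two_ne_zero
  have hnorm : ∀ i : Fin 2, ‖(EuclideanSpace.single i 1 : Plane)‖ = 1 := fun i => by simp
  have hsol : Solves s v (fun x => f (v x)) := fun x => by
    simp_rw [truncLap_eq]
    exact heq x
  rcases hcond with h0 | hmono
  · simp_rw [h0] at hsol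
    exact exists_profile hvd (c := 0) fun x => by
      rw [fderiv_eq_zero_of_harmonic hs hvb hv hsol (hnorm 0), zero_mul]
  · obtain ⟨M, hM⟩ := hvb
    obtain ⟨L, hL⟩ := (hf.locallyLipschitzOn (s := Icc (-M) M)).exists_lipschitzOnWith_of_compact
      isCompact_Icc
    have hfL : ∀ a b, |a| ≤ M → |b| ≤ M → |f a - f b| ≤ L * |a - b| := fun a b ha hb =>
      hL.dist_le_mul a (abs_le.1 ha) b (abs_le.1 hb)
    have hvL : LocLip v := LocLip.of_contDiff ⟨M, hM⟩ (hv.of_le (by norm_num))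
    obtain ⟨c, hc⟩ := exists_fderiv_eq_const_mul_of_monotone hs ⟨M, hM⟩ hv hsol
      (hvL.comp_of_lipschitz L.2 hM hfL) (fun x y => hfL _ _ (hM x) (hM y)) (hnorm 0) (hnorm 1)
      hmono
    exact exists_profile hvd hc
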